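/- arXiv:1811.09223 — 4 statements merged into one kernel-verified Lean document; each statement's English description precedes it below -/
import Mathlib

section
/- Let D and k be integers with 1 ≤ k ≤ D − 4, and let 𝓕 be a family of continuous maps f: H → V_{k,D} that is uniformly equicontinuous with respect to the Carnot–Carathéodory metric d on H (i.e., for every η > 0 there is δ > 0 such that |f(p) − f(q)| < η whenever f ∈ 𝓕 and p, q ∈ H satisfy d(p,q) < δ). Then there exists a uniformly equicontinuous family 𝓕̃ of continuous maps from H to V_{k+1,D} such that every f ∈ 𝓕 has a lift f̃ ∈ 𝓕̃, i.e. π ∘ f̃ = f. -/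
open scoped ENNReal NNReal RealInnerProductSpace BigOperators

noncomputable section

/-- The Heisenberg group `H`, identified as a set with `ℝ³`. -/
abbrev H : Type := ℝ × ℝ × ℝ

namespace Heisenberg

/-- The group law `[a,b,c]·[x,y,z] = [x+a, y+b, z+c+a·y]`. -/
def mul (p q : H) : H := (q.1 + p.1, q.2.1 + p.2.1, q.2.2 + p.2.2 + p.1 * q.2.1)

/-- The group inverse `[x,y,z]⁻¹ = [−x,−y,−z+xy]`. -/
def inv (p : H) : H := (-p.1, -p.2.1, -p.2.2 + p.1 * p.2.1)

/-- Membership in the integer lattice `Γ`. -/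
def inGamma (p : H) : Prop :=
  (∃ a : ℤ, p.1 = (a : ℝ)) ∧ (∃ b : ℤ, p.2.1 = (b : ℝ)) ∧ (∃ c : ℤ, p.2.2 = (c : ℝ))

/-- Flow along the vector field `X`: `exp(tX)[x,y,z] = [x+t, y, z+t·y]`. -/
def flowX (t : ℝ) (p : H) : H := (p.1 + t, p.2.1, p.2.2 + t * p.2.1)

/-- Flow along the vector field `Y`: `exp(tY)[x,y,z] = [x, y+t, z]`. -/
def flowY (t : ℝ) (p : H) : H := (p.1, p.2.1 + t, p.2.2)

def flow : Bool → ℝ → H → H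
  | true => flowX
  | false => flowY

/-- `applyFlows [(W₁,t₁),…,(W_k,t_k)] p = exp(t₁W₁)⋯exp(t_kW_k) p`. -/
def applyFlows : List (Bool × ℝ) → H → H
  | [], p => p
  | wt :: l, p => flow wt.1 wt.2 (applyFlows l p)

/-- The Carnot–Carathéodory metric on `H`. -/
def ccDist (p p' : H) : ℝ :=
  sInf { s | ∃ l : List (Bool × ℝ), applyFlows l p = p' ∧ s = (l.map fun wt => |wt.2|).sum }

/-- The parabolic dilation `δ_λ[x,y,z] = [λx, λy, λ²z]`. -/
def dilate (lam : ℝ) (p : H) : H := (lam * p.1, lam * p.2.1, lam ^ 2 * p.2.2)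

variable {E : Type*} [NormedAddCommGroup E] [NormedSpace ℝ E]

/-- The right-invariant vector field `X = ∂/∂x + y ∂/∂z` acting on functions. -/
def XD (φ : H → E) : H → E := fun p => fderiv ℝ φ p (1, 0, p.2.1)

/-- The right-invariant vector field `Y = ∂/∂y` acting on functions. -/
def YD (φ : H → E) : H → E := fun p => fderiv ℝ φ p (0, 1, 0)

/-- The vector field `Z = ∂/∂z` acting on functions. -/
def ZD (φ : H → E) : H → E := fun p => fderiv ℝ φ p (0, 0, 1)

def WD : Bool → (H → E) → H → E
  | true => XD
  | false => YD

/-- `X`, `Y`, `Z` indexed by `Fin 3`. -/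
def WD3 : Fin 3 → (H → E) → H → E := ![XD, YD, ZD]

/-- The pointwise (Euclidean) norm `|∇^j φ(p)|` of the `j`-th iterated horizontal
gradient `∇^jφ`, computed via the words of length `j` in `X, Y`. -/
def gradNorm (j : ℕ) (φ : H → E) (p : H) : ℝ :=
  Real.sqrt (∑ w : Fin j → Bool, ‖(List.ofFn w).foldr WD φ p‖ ^ 2)

/-- `‖∇^m φ‖_{C^k_R}`, valued in `ℝ≥0∞`. -/
def CkRS (m k : ℕ) (R : ℝ) (φ : H → E) : ℝ≥0∞ :=
  ∑ j ∈ Finset.range (k + 1),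
    ENNReal.ofReal (R ^ j) * ⨆ p : H, ENNReal.ofReal (gradNorm (m + j) φ p)

/-- The homogeneous Hölder seminorm `‖∇^m φ‖_{Ċ^{0,α}}`, valued in `ℝ≥0∞`. -/
def gradHolderS (m : ℕ) (α : ℝ) (φ : H → E) : ℝ≥0∞ :=
  ⨆ (p : H) (q : H) (_ : p ≠ q),
    ENNReal.ofReal (Real.sqrt (∑ w : Fin m → Bool,
        ‖(List.ofFn w).foldr WD φ p - (List.ofFn w).foldr WD φ q‖ ^ 2)) /
      ENNReal.ofReal (ccDist p q ^ α)

/-- `‖∇^m φ‖_{C^{k,α}_R}`, valued in `ℝ≥0∞`. -/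
def CkAS (m k : ℕ) (α R : ℝ) (φ : H → E) : ℝ≥0∞ :=
  CkRS m k R φ + ENNReal.ofReal (R ^ ((k : ℝ) + α)) * gradHolderS (m + k) α φ

/-- `‖φ‖_{C^k_R}`. -/
abbrev CkR (k : ℕ) (R : ℝ) (φ : H → E) : ℝ≥0∞ := CkRS 0 k R φ

/-- `‖φ‖_{C^{k,α}_R}`. -/
abbrev CkA (k : ℕ) (α R : ℝ) (φ : H → E) : ℝ≥0∞ := CkAS 0 k α R φ

/-- A dyadic number is one of the form `2^m`, `m ∈ ℤ`. -/
def IsDyadic (A : ℝ) : Prop := ∃ m : ℤ, A = 2 ^ m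

/-- The norm `|v₁ ∧ ⋯ ∧ v_k|` of a wedge product of vectors of `ℝ^D`, via the
Cauchy–Binet (Gram determinant) formula. -/
def wedgeNorm {D k : ℕ} (v : Fin k → EuclideanSpace ℝ (Fin D)) : ℝ :=
  Real.sqrt (Matrix.det (Matrix.of fun i j => ⟪v i, v j⟫))

end Heisenberg

open Heisenberg

/-- The Stiefel manifold `V_{k,D}` of orthonormal `k`-frames in `ℝ^D`. -/
def Stiefel (k D : ℕ) : Type :=
  { v : Fin k → EuclideanSpace ℝ (Fin D) // Orthonormal ℝ v }

instance (k D : ℕ) : TopologicalSpace (Stiefel k D) :=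
  inferInstanceAs (TopologicalSpace { v : Fin k → EuclideanSpace ℝ (Fin D) // Orthonormal ℝ v })

/-- The projection `π : V_{k+1,D} → V_{k,D}` forgetting the last vector. -/
def stiefelProj {k D : ℕ} (v : Stiefel (k + 1) D) : Stiefel k D :=
  ⟨fun i => v.1 i.castSucc, v.2.comp Fin.castSucc (Fin.castSucc_injective k)⟩

/-- The Euclidean distance between two `k`-tuples of vectors of `ℝ^D`. -/
noncomputable def tupleDist {k D : ℕ} (v w : Fin k → EuclideanSpace ℝ (Fin D)) : ℝ :=
  Real.sqrt (∑ i, ‖v i - w i‖ ^ 2)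

/-! ### The Carnot–Carathéodory metric -/

theorem exists_applyFlows (p q : H) (l : ℝ) :
    ∃ L : List (Bool × ℝ), applyFlows L p = q ∧ (L.map fun wt => |wt.2|).sum =
      |q.2.1 - l| + |q.1 - p.1| + 2 + 2 * |q.2.2 - p.2.2 - l * (q.1 - p.1)| + |p.2.1 - l| := by
  refine ⟨[(false, q.2.1 - l), (true, -(q.2.2 - p.2.2 - l * (q.1 - p.1))), (false, -1),
    (true, q.2.2 - p.2.2 - l * (q.1 - p.1)), (false, 1), (true, q.1 - p.1),
    (false, l - p.2.1)], ?_, ?_⟩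
  · simp only [applyFlows, flow, flowX, flowY]
    ext <;> simp <;> ring
  · simp only [List.map_cons, List.map_nil, List.sum_cons, List.sum_nil, abs_neg, abs_one,
      abs_sub_comm l p.2.1]
    ring

theorem sum_abs_nonneg (L : List (Bool × ℝ)) : 0 ≤ (L.map fun wt => |wt.2|).sum := by
  refine List.sum_nonneg fun x hx => ?_
  obtain ⟨wt, -, rfl⟩ := List.mem_map.1 hx
  exact abs_nonneg _

theorem ccDist_le {p q : H} {L : List (Bool × ℝ)} (h : applyFlows L p = q) :
    ccDist p q ≤ (L.map fun wt => |wt.2|).sum := by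
  refine csInf_le ⟨0, ?_⟩ ⟨L, h, rfl⟩
  rintro s ⟨L', -, rfl⟩
  exact sum_abs_nonneg L'

theorem exists_applyFlows_of_ccDist_lt {p q : H} {s : ℝ} (h : ccDist p q < s) :
    ∃ L : List (Bool × ℝ), applyFlows L p = q ∧ (L.map fun wt => |wt.2|).sum < s := by
  obtain ⟨L₀, h₀, -⟩ := exists_applyFlows p q 0
  have hne : { s | ∃ L : List (Bool × ℝ), applyFlows L p = q ∧
      s = (L.map fun wt => |wt.2|).sum }.Nonempty := ⟨_, L₀, h₀, rfl⟩
  obtain ⟨_, ⟨L, hL, rfl⟩, hs⟩ := exists_lt_of_csInf_lt hne h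
  exact ⟨L, hL, hs⟩

theorem applyFlows_dilate (c : ℝ) (L : List (Bool × ℝ)) (p : H) :
    applyFlows (L.map fun wt => (wt.1, c * wt.2)) (dilate c p) = dilate c (applyFlows L p) := by
  induction L with
  | nil => rfl
  | cons wt L ih =>
    obtain ⟨w, t⟩ := wt
    simp only [List.map_cons, applyFlows, ih]
    cases w <;> simp only [flow, flowX, flowY, dilate] <;> ext <;> simp <;> ring

theorem sum_abs_dilate {c : ℝ} (hc : 0 ≤ c) (L : List (Bool × ℝ)) :
    ((L.map fun wt => (wt.1, c * wt.2)).map fun wt => |wt.2|).sum =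
      c * (L.map fun wt => |wt.2|).sum := by
  induction L with
  | nil => simp
  | cons wt L ih =>
    simp only [List.map_cons, List.sum_cons, ih, abs_mul, abs_of_nonneg hc]
    ring

theorem dilate_dilate_inv {c : ℝ} (hc : c ≠ 0) (p : H) : dilate c (dilate c⁻¹ p) = p := by
  simp only [dilate]
  ext <;> simp <;> field_simp

/-- `p` and `q` differ by at most `s` in the coordinates of the tangent plane at `p`. -/
def IsNear (s : ℝ) (p q : H) : Prop :=
  |q.1 - p.1| ≤ s ∧ |q.2.1 - p.2.1| ≤ s ∧ |q.2.2 - p.2.2 - p.2.1 * (q.1 - p.1)| ≤ s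

theorem abs_applyFlows_sub_le (L : List (Bool × ℝ)) (p : H) :
    |(applyFlows L p).1 - p.1| ≤ (L.map fun wt => |wt.2|).sum ∧
    |(applyFlows L p).2.1 - p.2.1| ≤ (L.map fun wt => |wt.2|).sum ∧
    |(applyFlows L p).2.2 - p.2.2 - p.2.1 * ((applyFlows L p).1 - p.1)| ≤
      (L.map fun wt => |wt.2|).sum ^ 2 := by
  induction L with
  | nil => simp [applyFlows]
  | cons wt L ih =>
    obtain ⟨w, t⟩ := wt
    simp only [List.map_cons, List.sum_cons, applyFlows]
    have hs : 0 ≤ (L.map fun wt => |wt.2|).sum := sum_abs_nonneg L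
    generalize (L.map fun wt => |wt.2|).sum = s at *
    generalize applyFlows L p = q at *
    obtain ⟨h1, h2, h3⟩ := ih
    have ht := abs_nonneg t
    cases w
    · simp only [flow, flowY]
      refine ⟨by linarith, ?_, h3.trans (by nlinarith)⟩
      have := abs_add_le (q.2.1 - p.2.1) t
      rw [show q.2.1 + t - p.2.1 = q.2.1 - p.2.1 + t by ring]
      linarith
    · simp only [flow, flowX]
      refine ⟨?_, by linarith, ?_⟩
      · have := abs_add_le (q.1 - p.1) t
        rw [show q.1 + t - p.1 = q.1 - p.1 + t by ring]
        linarith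
      · rw [show q.2.2 + t * q.2.1 - p.2.2 - p.2.1 * (q.1 + t - p.1) =
          (q.2.2 - p.2.2 - p.2.1 * (q.1 - p.1)) + t * (q.2.1 - p.2.1) by ring]
        have h4 := abs_add_le (q.2.2 - p.2.2 - p.2.1 * (q.1 - p.1)) (t * (q.2.1 - p.2.1))
        have h5 : |t * (q.2.1 - p.2.1)| ≤ |t| * s := by
          rw [abs_mul]
          gcongr
        nlinarith

theorem isNear_dilate_of_ccDist_lt {c s : ℝ} (hc : 0 < c) (hs : s ≤ 1) {p q : H}
    (h : ccDist p q < c * s) : IsNear s (dilate c⁻¹ p) (dilate c⁻¹ q) := by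
  obtain ⟨L, hL, hLs⟩ := exists_applyFlows_of_ccDist_lt h
  have hL' := applyFlows_dilate c⁻¹ L p
  rw [hL] at hL'
  have hsum := sum_abs_dilate (inv_nonneg.2 hc.le) L
  have hlt : c⁻¹ * (L.map fun wt => |wt.2|).sum < s := by
    rwa [inv_mul_lt_iff₀ hc]
  rw [← hsum] at hlt
  have h0 : 0 ≤ ((L.map fun wt => (wt.1, c⁻¹ * wt.2)).map fun wt => |wt.2|).sum :=
    sum_abs_nonneg _
  obtain ⟨h1, h2, h3⟩ := abs_applyFlows_sub_le (L.map fun wt => (wt.1, c⁻¹ * wt.2)) (dilate c⁻¹ p)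
  rw [hL'] at h1 h2 h3
  exact ⟨by linarith, by linarith, by nlinarith⟩

/-! ### A decomposition of the Heisenberg group into four families of cells -/

/-- The cell of the `j`-th family containing the point `p`. -/
def cellIndex (j : ℕ) (p : H) : ℤ × ℤ × ℤ :=
  (⌊p.2.1 - j / 4⌋, ⌊p.1 - j / 4 - 1 / 8⌋, ⌊p.2.2 - ⌊p.2.1 - (j : ℝ) / 4⌋ * p.1 - j / 4⌋)

/-- A point of the cell `c` of the `j`-th family. -/
def cellBase (j : ℕ) (c : ℤ × ℤ × ℤ) : H :=
  (c.2.1 + j / 4 + 1 / 8, c.1 + j / 4, c.2.2 + c.1 * (c.2.1 + j / 4 + 1 / 8) + j / 4)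

theorem ccDist_dilate_cellBase_le {c : ℝ} (hc : 0 < c) {j : ℕ} (hj : j < 4) (p : H) :
    ccDist p (dilate c (cellBase j (cellIndex j (dilate c⁻¹ p)))) ≤ c * 9 := by
  set P := dilate c⁻¹ p with hP
  set l : ℝ := (⌊P.2.1 - (j : ℝ) / 4⌋ : ℝ) with hl
  obtain ⟨L, hL, hs⟩ := exists_applyFlows P (cellBase j (cellIndex j P)) l
  have h := applyFlows_dilate c L P
  rw [hL, hP, dilate_dilate_inv hc.ne'] at h
  refine (ccDist_le h).trans ?_
  rw [sum_abs_dilate hc.le, hs]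
  gcongr
  have hj0 : (0 : ℝ) ≤ j := by positivity
  have hj4 : (j : ℝ) ≤ 3 := by exact_mod_cast Nat.le_of_lt_succ hj
  have a1 := Int.floor_le (P.2.1 - (j : ℝ) / 4)
  have a2 := Int.lt_floor_add_one (P.2.1 - (j : ℝ) / 4)
  have b1 := Int.floor_le (P.1 - (j : ℝ) / 4 - 1 / 8)
  have b2 := Int.lt_floor_add_one (P.1 - (j : ℝ) / 4 - 1 / 8)
  have c1 := Int.floor_le (P.2.2 - l * P.1 - j / 4)
  have c2 := Int.lt_floor_add_one (P.2.2 - l * P.1 - j / 4)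
  rw [← hl] at a1 a2
  simp only [cellBase, cellIndex, ← hl]
  generalize (⌊P.1 - (j : ℝ) / 4 - 1 / 8⌋ : ℝ) = m at *
  generalize (⌊P.2.2 - l * P.1 - j / 4⌋ : ℝ) = n at *
  have e1 : |l + (j : ℝ) / 4 - l| ≤ 1 := abs_le.2 ⟨by linarith, by linarith⟩
  have e2 : |m + (j : ℝ) / 4 + 1 / 8 - P.1| ≤ 1 := abs_le.2 ⟨by linarith, by linarith⟩
  have e3 : |n + l * (m + (j : ℝ) / 4 + 1 / 8) + j / 4 - P.2.2 -
      l * (m + (j : ℝ) / 4 + 1 / 8 - P.1)| ≤ 1 := abs_le.2 ⟨by linarith, by linarith⟩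
  have e4 : |P.2.1 - l| ≤ 2 := abs_le.2 ⟨by linarith, by linarith⟩
  linarith

/-- The distance to the nearest integer, truncated near the integers. -/
def bump (t : ℝ) : ℝ := max 0 (min (Int.fract t) (1 - Int.fract t) - 1 / 64)

theorem bump_nonneg (t : ℝ) : 0 ≤ bump t := le_max_left _ _

theorem bump_le_one (t : ℝ) : bump t ≤ 1 := by
  have := Int.fract_lt_one t
  exact max_le zero_le_one (by linarith [min_le_left (Int.fract t) (1 - Int.fract t)])

theorem exists_abs_sub_lt_of_bump_lt {t : ℝ} (h : bump t < 1 / 64) :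
    ∃ a : ℤ, |t - a| < 1 / 32 := by
  have h' := (le_max_right _ _).trans_lt h
  have h0 := Int.fract_nonneg t
  have h1 := Int.fract_lt_one t
  have h2 := Int.floor_add_fract t
  rcases min_lt_iff.1 (show min (Int.fract t) (1 - Int.fract t) < 1 / 32 by linarith) with h3 | h3
  · exact ⟨⌊t⌋, abs_lt.2 ⟨by linarith, by linarith⟩⟩
  · exact ⟨⌊t⌋ + 1, abs_lt.2 (by push_cast; constructor <;> linarith)⟩

theorem abs_bump_sub_le {t u s : ℝ} (h : ⌊t⌋ = ⌊u⌋) (htu : |u - t| ≤ s) :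
    |bump u - bump t| ≤ s := by
  have h1 : Int.fract u - Int.fract t = u - t := by
    simp only [Int.fract, h]
    ring
  have h2 : |Int.fract u - Int.fract t| ≤ s := h1 ▸ htu
  have h3 : |(1 - Int.fract u) - (1 - Int.fract t)| ≤ s := by
    rw [abs_sub_comm] at h2
    convert h2 using 2
    ring
  unfold bump
  refine (abs_max_sub_max_le_max _ _ _ _).trans (max_le ?_ ?_)
  · simpa using (abs_nonneg _).trans htu
  · rw [sub_sub_sub_cancel_right]
    exact (abs_min_sub_min_le_max _ _ _ _).trans (max_le h2 h3)

theorem bump_eq_zero_of_floor_ne {t u : ℝ} (h : ⌊t⌋ ≠ ⌊u⌋) (htu : |u - t| ≤ 1 / 64) :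
    bump t = 0 ∧ bump u = 0 := by
  wlog hlt : ⌊t⌋ < ⌊u⌋ generalizing t u
  · exact (this h.symm (by rwa [abs_sub_comm]) (lt_of_le_of_ne (not_lt.1 hlt) h.symm)).symm
  have h1 : (⌊t⌋ : ℝ) + 1 ≤ ⌊u⌋ := by exact_mod_cast hlt
  have h2 := Int.floor_add_fract t
  have h3 := Int.floor_add_fract u
  have h4 := Int.fract_nonneg u
  have h5 := Int.fract_lt_one t
  have h6 := (abs_le.1 htu).2
  constructor
  · exact max_eq_left (by linarith [min_le_right (Int.fract t) (1 - Int.fract t)])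
  · exact max_eq_left (by linarith [min_le_left (Int.fract u) (1 - Int.fract u)])

/-- The weight of the `j`-th family of cells. -/
def cellWeight (j : ℕ) (p : H) : ℝ :=
  min (bump (p.2.1 - j / 4)) (min (bump (p.1 - j / 4 - 1 / 8))
    (bump (p.2.2 - ⌊p.2.1 - (j : ℝ) / 4⌋ * p.1 - j / 4)))

theorem cellWeight_nonneg (j : ℕ) (p : H) : 0 ≤ cellWeight j p :=
  le_min (bump_nonneg _) (le_min (bump_nonneg _) (bump_nonneg _))

theorem cellWeight_le_one (j : ℕ) (p : H) : cellWeight j p ≤ 1 :=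
  (min_le_left _ _).trans (bump_le_one _)

theorem cellIndex_eq_or_cellWeight_eq_zero {s : ℝ} (hs : s ≤ 1 / 192) {p q : H}
    (h : IsNear s p q) {j : ℕ} (hj : j < 4) :
    (cellIndex j p = cellIndex j q ∧ |cellWeight j q - cellWeight j p| ≤ 3 * s) ∨
      (cellWeight j p = 0 ∧ cellWeight j q = 0) := by
  obtain ⟨h1, h2, h3⟩ := h
  have hs0 : 0 ≤ s := (abs_nonneg _).trans h1
  have zero_of {a b c : ℝ} (ha : 0 ≤ a) (hb : 0 ≤ b) (hc : 0 ≤ c)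
      (h : a = 0 ∨ b = 0 ∨ c = 0) : min a (min b c) = 0 := by
    refine le_antisymm ?_ (le_min ha (le_min hb hc))
    rcases h with h | h | h <;> simp [h]
  have hy : |(q.2.1 - j / 4) - (p.2.1 - (j : ℝ) / 4)| ≤ s := by
    convert h2 using 2
    ring
  have hx : |(q.1 - j / 4 - 1 / 8) - (p.1 - (j : ℝ) / 4 - 1 / 8)| ≤ s := by
    convert h1 using 2
    ring
  by_cases ey : ⌊p.2.1 - (j : ℝ) / 4⌋ = ⌊q.2.1 - (j : ℝ) / 4⌋
  swap
  · obtain ⟨z1, z2⟩ := bump_eq_zero_of_floor_ne ey (by linarith)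
    exact Or.inr ⟨zero_of (bump_nonneg _) (bump_nonneg _) (bump_nonneg _) (Or.inl z1),
      zero_of (bump_nonneg _) (bump_nonneg _) (bump_nonneg _) (Or.inl z2)⟩
  by_cases ex : ⌊p.1 - (j : ℝ) / 4 - 1 / 8⌋ = ⌊q.1 - (j : ℝ) / 4 - 1 / 8⌋
  swap
  · obtain ⟨z1, z2⟩ := bump_eq_zero_of_floor_ne ex (by linarith)
    exact Or.inr ⟨zero_of (bump_nonneg _) (bump_nonneg _) (bump_nonneg _) (Or.inr (Or.inl z1)),
      zero_of (bump_nonneg _) (bump_nonneg _) (bump_nonneg _) (Or.inr (Or.inl z2))⟩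
  have hz : |(q.2.2 - ⌊q.2.1 - (j : ℝ) / 4⌋ * q.1 - j / 4) -
      (p.2.2 - ⌊p.2.1 - (j : ℝ) / 4⌋ * p.1 - j / 4)| ≤ 3 * s := by
    rw [← ey]
    have hj0 : (0 : ℝ) ≤ j := by positivity
    have hj4 : (j : ℝ) ≤ 3 := by exact_mod_cast Nat.le_of_lt_succ hj
    have a1 := Int.floor_le (p.2.1 - (j : ℝ) / 4)
    have a2 := Int.lt_floor_add_one (p.2.1 - (j : ℝ) / 4)
    generalize (⌊p.2.1 - (j : ℝ) / 4⌋ : ℝ) = l at *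
    rw [show (q.2.2 - l * q.1 - j / 4) - (p.2.2 - l * p.1 - j / 4) =
      (q.2.2 - p.2.2 - p.2.1 * (q.1 - p.1)) + (p.2.1 - l) * (q.1 - p.1) by ring]
    refine (abs_add_le _ _).trans ?_
    have e : |p.2.1 - l| ≤ 2 := abs_le.2 ⟨by linarith, by linarith⟩
    have : |(p.2.1 - l) * (q.1 - p.1)| ≤ 2 * s := by
      rw [abs_mul]
      gcongr
    linarith
  by_cases ez : ⌊p.2.2 - ⌊p.2.1 - (j : ℝ) / 4⌋ * p.1 - j / 4⌋ =
      ⌊q.2.2 - ⌊q.2.1 - (j : ℝ) / 4⌋ * q.1 - j / 4⌋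
  swap
  · obtain ⟨z1, z2⟩ := bump_eq_zero_of_floor_ne ez (by linarith)
    exact Or.inr ⟨zero_of (bump_nonneg _) (bump_nonneg _) (bump_nonneg _) (Or.inr (Or.inr z1)),
      zero_of (bump_nonneg _) (bump_nonneg _) (bump_nonneg _) (Or.inr (Or.inr z2))⟩
  refine Or.inl ⟨Prod.ext ey (Prod.ext ex ez), ?_⟩
  refine (abs_min_sub_min_le_max _ _ _ _).trans (max_le ?_
    ((abs_min_sub_min_le_max _ _ _ _).trans (max_le ?_ ?_)))
  · exact (abs_bump_sub_le ey hy).trans (by linarith)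
  · exact (abs_bump_sub_le ex hx).trans (by linarith)
  · exact abs_bump_sub_le ez hz

theorem eq_of_abs_sub_quarter_lt {t : ℝ} {i j : ℕ} (hi : i < 4) (hj : j < 4)
    (h : ∃ a : ℤ, |t - i / 4 - a| < 1 / 32) (h' : ∃ a : ℤ, |t - j / 4 - a| < 1 / 32) : i = j := by
  obtain ⟨a, ha⟩ := h
  obtain ⟨b, hb⟩ := h'
  rw [abs_lt] at ha hb
  have h1 : ((j + 4 * b - i - 4 * a : ℤ) : ℝ) < 1 := by push_cast; linarith
  have h2 : (-1 : ℝ) < ((j + 4 * b - i - 4 * a : ℤ) : ℝ) := by push_cast; linarith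
  have h1' : (j + 4 * b - i - 4 * a : ℤ) < 1 := by exact_mod_cast h1
  have h2' : (-1 : ℤ) < (j + 4 * b - i - 4 * a : ℤ) := by exact_mod_cast h2
  omega

theorem exists_le_cellWeight (p : H) : ∃ j : Fin 4, 1 / 64 ≤ cellWeight j p := by
  by_contra! hcon
  obtain ⟨x, y, z⟩ := p
  let l : ℕ → ℤ := fun j => ⌊y - (j : ℝ) / 4⌋
  let PY : ℕ → Prop := fun j => ∃ a : ℤ, |y - j / 4 - a| < 1 / 32
  let PX : ℕ → Prop := fun j => ∃ a : ℤ, |x - 1 / 8 - j / 4 - a| < 1 / 32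
  let PZ : ℕ → Prop := fun j => ∃ a : ℤ, |z - l j * x - j / 4 - a| < 1 / 32
  have miss (j : ℕ) (hj : j < 4) : PY j ∨ PX j ∨ PZ j := by
    have h := hcon ⟨j, hj⟩
    simp only [cellWeight, min_lt_iff] at h
    refine h.imp exists_abs_sub_lt_of_bump_lt (Or.imp (fun h => ?_) exists_abs_sub_lt_of_bump_lt)
    rw [sub_right_comm] at h
    exact exists_abs_sub_lt_of_bump_lt h
  have hY (i j : ℕ) (hi : i < 4) (hj : j < 4) (h : PY i) (h' : PY j) : i = j :=
    eq_of_abs_sub_quarter_lt hi hj h h'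
  have hX (i j : ℕ) (hi : i < 4) (hj : j < 4) (h : PX i) (h' : PX j) : i = j :=
    eq_of_abs_sub_quarter_lt hi hj h h'
  have hZ (i j : ℕ) (hi : i < 4) (hj : j < 4) (h : PZ i) (h' : PZ j) (hl : l i = l j) :
      i = j := by
    refine eq_of_abs_sub_quarter_lt (t := z - l j * x) hi hj ?_ h'
    rw [← hl]
    exact h
  have hl (j : ℕ) (hj : j < 4) : l j = l 0 ∨ l j = l 0 - 1 := by
    have hj0 : (0 : ℝ) ≤ j := by positivity
    have hj4 : (j : ℝ) ≤ 3 := by exact_mod_cast Nat.le_of_lt_succ hj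
    have a1 := Int.floor_le (y - (j : ℝ) / 4)
    have a2 := Int.lt_floor_add_one (y - (j : ℝ) / 4)
    have b1 := Int.floor_le (y - ((0 : ℕ) : ℝ) / 4)
    have b2 := Int.lt_floor_add_one (y - ((0 : ℕ) : ℝ) / 4)
    change (l j : ℝ) ≤ _ at a1
    change _ < (l j : ℝ) + 1 at a2
    change (l 0 : ℝ) ≤ _ at b1
    change _ < (l 0 : ℝ) + 1 at b2
    push_cast at b1 b2
    have c1 : (l j : ℝ) < l 0 + 1 := by linarith
    have c2 : (l 0 : ℝ) < l j + 2 := by linarith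
    have c1' : l j < l 0 + 1 := by exact_mod_cast c1
    have c2' : l 0 < l j + 2 := by exact_mod_cast c2
    omega
  have hXZ (i j m : ℕ) (hi : l i = l 0) (hj : l j = l 0 - 1)
      (h : PZ i) (h' : PZ j) (h'' : PX m) : False := by
    obtain ⟨a, ha⟩ := h
    obtain ⟨b, hb⟩ := h'
    obtain ⟨c, hc⟩ := h''
    rw [hi] at ha
    rw [hj] at hb
    push_cast at hb
    rw [abs_lt] at ha hb hc
    have h1 : ((2 * (j + 4 * b - i - 4 * a) - 1 - 2 * m - 8 * c : ℤ) : ℝ) < 1 := by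
      push_cast; linarith
    have h2 : (-1 : ℝ) < ((2 * (j + 4 * b - i - 4 * a) - 1 - 2 * m - 8 * c : ℤ) : ℝ) := by
      push_cast; linarith
    have h1' : (2 * (j + 4 * b - i - 4 * a) - 1 - 2 * m - 8 * c : ℤ) < 1 := by exact_mod_cast h1
    have h2' : (-1 : ℤ) < (2 * (j + 4 * b - i - 4 * a) - 1 - 2 * m - 8 * c : ℤ) := by
      exact_mod_cast h2
    omega
  clear_value l PY PX PZ
  clear hcon
  have m0 := miss 0 (by norm_num)
  have m1 := miss 1 (by norm_num)
  have m2 := miss 2 (by norm_num)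
  have m3 := miss 3 (by norm_num)
  have l1 := hl 1 (by norm_num)
  have l2 := hl 2 (by norm_num)
  have l3 := hl 3 (by norm_num)
  have hZ' (i j : ℕ) (hi : i < 4) (hj : j < 4) (hij : i ≠ j) (h : PZ i) (h' : PZ j) :
      (l i ≠ l j) ∧ ∀ m, ¬ PX m := by
    have hne : l i ≠ l j := fun e => hij (hZ i j hi hj h h' e)
    refine ⟨hne, fun m hm => ?_⟩
    rcases hl i hi with e | e <;> rcases hl j hj with e' | e'
    · exact hne (e.trans e'.symm)
    · exact hXZ i j m e e' h h' hm
    · exact hXZ j i m e' e h' h hm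
    · exact hne (e.trans e'.symm)
  have y01 := hY 0 1
  have y02 := hY 0 2
  have y03 := hY 0 3
  have y12 := hY 1 2
  have y13 := hY 1 3
  have y23 := hY 2 3
  have x01 := hX 0 1
  have x02 := hX 0 2
  have x03 := hX 0 3
  have x12 := hX 1 2
  have x13 := hX 1 3
  have x23 := hX 2 3
  have z01 := hZ' 0 1
  have z02 := hZ' 0 2
  have z03 := hZ' 0 3
  have z12 := hZ' 1 2
  have z13 := hZ' 1 3
  have z23 := hZ' 2 3
  clear hX hY hZ hZ' hXZ hl miss
  norm_num at *
  grind

/-- The cell displaced from `c` by the offset `o - (4, 4, 4)`, in coordinates adapted to `c`. -/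
def cellShift (c : ℤ × ℤ × ℤ) (o : Fin 9 × Fin 9 × Fin 9) : ℤ × ℤ × ℤ :=
  (c.1 + ((o.1 : ℕ) - 4), c.2.1 + ((o.2.1 : ℕ) - 4),
    c.2.2 - ((o.1 : ℕ) - 4) * c.2.1 + ((o.2.2 : ℕ) - 4))

theorem exists_cellIndex_eq_cellShift {i j : ℕ} (hi : i < 4) (hj : j < 4) (p : H) :
    ∃ o, cellIndex i p = cellShift (cellIndex j p) o := by
  obtain ⟨x, y, z⟩ := p
  have hi0 : (0 : ℝ) ≤ i := by positivity
  have hi4 : (i : ℝ) ≤ 3 := by exact_mod_cast Nat.le_of_lt_succ hi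
  have hj0 : (0 : ℝ) ≤ j := by positivity
  have hj4 : (j : ℝ) ≤ 3 := by exact_mod_cast Nat.le_of_lt_succ hj
  simp only [cellIndex]
  have a1 := Int.floor_le (y - (i : ℝ) / 4)
  have a2 := Int.lt_floor_add_one (y - (i : ℝ) / 4)
  have b1 := Int.floor_le (y - (j : ℝ) / 4)
  have b2 := Int.lt_floor_add_one (y - (j : ℝ) / 4)
  have c1 := Int.floor_le (x - (i : ℝ) / 4 - 1 / 8)
  have c2 := Int.lt_floor_add_one (x - (i : ℝ) / 4 - 1 / 8)
  have d1 := Int.floor_le (x - (j : ℝ) / 4 - 1 / 8)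
  have d2 := Int.lt_floor_add_one (x - (j : ℝ) / 4 - 1 / 8)
  generalize ⌊y - (i : ℝ) / 4⌋ = l at *
  generalize ⌊y - (j : ℝ) / 4⌋ = l' at *
  generalize ⌊x - (i : ℝ) / 4 - 1 / 8⌋ = m at *
  generalize ⌊x - (j : ℝ) / 4 - 1 / 8⌋ = m' at *
  have e1 := Int.floor_le (z - l * x - (i : ℝ) / 4)
  have e2 := Int.lt_floor_add_one (z - l * x - (i : ℝ) / 4)
  have f1 := Int.floor_le (z - l' * x - (j : ℝ) / 4)
  have f2 := Int.lt_floor_add_one (z - l' * x - (j : ℝ) / 4)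
  generalize ⌊z - l * x - (i : ℝ) / 4⌋ = n at *
  generalize ⌊z - l' * x - (j : ℝ) / 4⌋ = n' at *
  have hl1 : l - l' < 2 := by
    have : ((l - l' : ℤ) : ℝ) < 2 := by push_cast; linarith
    exact_mod_cast this
  have hl2 : -2 < l - l' := by
    have : (-2 : ℝ) < ((l - l' : ℤ) : ℝ) := by push_cast; linarith
    exact_mod_cast this
  have hm1 : m - m' < 2 := by
    have : ((m - m' : ℤ) : ℝ) < 2 := by push_cast; linarith
    exact_mod_cast this
  have hm2 : -2 < m - m' := by
    have : (-2 : ℝ) < ((m - m' : ℤ) : ℝ) := by push_cast; linarith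
    exact_mod_cast this
  have hle : |((l : ℝ) - l') * (x - m')| ≤ 1 * 2 := by
    rw [abs_mul]
    refine mul_le_mul ?_ (abs_le.2 ⟨by linarith, by linarith⟩) (abs_nonneg _) zero_le_one
    have : |l - l'| ≤ 1 := abs_le.2 ⟨by omega, by omega⟩
    exact_mod_cast this
  obtain ⟨g1, g2⟩ := abs_le.1 hle
  have hn1 : n - n' + (l - l') * m' < 4 := by
    have : ((n - n' + (l - l') * m' : ℤ) : ℝ) < 4 := by push_cast; linarith
    exact_mod_cast this
  have hn2 : -4 < n - n' + (l - l') * m' := by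
    have : (-4 : ℝ) < ((n - n' + (l - l') * m' : ℤ) : ℝ) := by push_cast; linarith
    exact_mod_cast this
  refine ⟨(⟨(l - l' + 4).toNat, by omega⟩, ⟨(m - m' + 4).toNat, by omega⟩,
    ⟨(n - n' + (l - l') * m' + 4).toNat, by omega⟩), ?_⟩
  have t1 : (((l - l' + 4).toNat : ℕ) : ℤ) = l - l' + 4 := Int.toNat_of_nonneg (by omega)
  have t2 : (((m - m' + 4).toNat : ℕ) : ℤ) = m - m' + 4 := Int.toNat_of_nonneg (by omega)
  have t3 : (((n - n' + (l - l') * m' + 4).toNat : ℕ) : ℤ) = n - n' + (l - l') * m' + 4 :=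
    Int.toNat_of_nonneg (by omega)
  simp only [cellShift, t1, t2, t3, Prod.mk.injEq]
  refine ⟨by ring, by ring, by ring⟩

/-! ### Quantitative general position -/

section GeneralPosition

variable {V : Type*} [NormedAddCommGroup V] [InnerProductSpace ℝ V]

theorem exists_pow_le_abs_inner (s : Finset V) (hs : ∀ n ∈ s, ‖n‖ = 1) :
    ∃ a : V, ‖a‖ ≤ 1 ∧ ∀ n ∈ s, (1 / 8 : ℝ) ^ s.card ≤ |inner ℝ n a| := by
  classical
  induction s using Finset.induction_on with
  | empty => exact ⟨0, by simp, by simp⟩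
  | insert n s hn ih =>
    obtain ⟨a, ha, has⟩ := ih fun m hm => hs m (Finset.mem_insert_of_mem hm)
    rw [Finset.card_insert_of_notMem hn, pow_succ]
    have hκ0 : (0 : ℝ) < (1 / 8) ^ s.card := by positivity
    have hκ1 : ((1 : ℝ) / 8) ^ s.card ≤ 1 := pow_le_one₀ (by norm_num) (by norm_num)
    generalize ((1 : ℝ) / 8) ^ s.card = κ at *
    by_cases h : κ / 8 ≤ |inner ℝ n a|
    · refine ⟨a, ha, fun m hm => ?_⟩
      rcases Finset.mem_insert.1 hm with rfl | hm
      · linarith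
      · linarith [has m hm]
    · have hn1 : ‖n‖ = 1 := hs n (Finset.mem_insert_self _ _)
      refine ⟨(1 / 2 : ℝ) • (a + (κ / 2) • n), ?_, fun m hm => ?_⟩
      · rw [norm_smul, Real.norm_of_nonneg (by norm_num)]
        have := norm_add_le a ((κ / 2) • n)
        rw [norm_smul, hn1, Real.norm_of_nonneg (by positivity)] at this
        linarith
      · rw [inner_smul_right, inner_add_right, inner_smul_right, abs_mul,
          abs_of_pos (show (0 : ℝ) < 1 / 2 by norm_num)]
        rcases Finset.mem_insert.1 hm with rfl | hm
        · rw [real_inner_self_eq_norm_sq, hn1]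
          have h1 := abs_lt.1 (not_le.1 h)
          have h2 := le_abs_self (inner ℝ m a + κ / 2 * 1 ^ 2)
          linarith
        · have h1 : |inner ℝ m n| ≤ 1 := by
            have := abs_real_inner_le_norm m n
            rwa [hn1, hs m (Finset.mem_insert_of_mem hm), one_mul] at this
          have h2 : |κ / 2 * inner ℝ m n| ≤ κ / 2 := by
            rw [abs_mul, abs_of_pos (by positivity : 0 < κ / 2)]
            nlinarith
          have h3 := abs_sub_abs_le_abs_sub (inner ℝ m a) (-(κ / 2 * inner ℝ m n))
          rw [abs_neg, sub_neg_eq_add] at h3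
          linarith [has m hm]

theorem exists_pow_card_le_abs_inner {τ : Type*} [Fintype τ] (n : τ → V) (hn : ∀ i, ‖n i‖ = 1) :
    ∃ a : V, ‖a‖ ≤ 1 ∧ ∀ i, (1 / 8 : ℝ) ^ Fintype.card τ ≤ |inner ℝ (n i) a| := by
  classical
  obtain ⟨a, ha, h⟩ := exists_pow_le_abs_inner (Finset.univ.image n) (by simp [hn])
  refine ⟨a, ha, fun i => le_trans ?_ (h _ (Finset.mem_image_of_mem _ (Finset.mem_univ i)))⟩
  exact pow_le_pow_of_le_one (by norm_num) (by norm_num) Finset.card_image_le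

theorem exists_norm_eq_one_inner_eq_zero [FiniteDimensional ℝ V] {ι : Type*} [Fintype ι]
    (w : ι → V) (h : Fintype.card ι < Module.finrank ℝ V) :
    ∃ n : V, ‖n‖ = 1 ∧ ∀ i, inner ℝ n (w i) = 0 := by
  let T : V →ₗ[ℝ] (ι → ℝ) := LinearMap.pi fun i => (innerₛₗ ℝ (w i))
  have hT : LinearMap.ker T ≠ ⊥ :=
    LinearMap.ker_ne_bot_of_finrank_lt (by rwa [Module.finrank_fintype_fun_eq_card])
  obtain ⟨v, hv, hv0⟩ := Submodule.exists_mem_ne_zero_of_ne_bot hT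
  refine ⟨‖v‖⁻¹ • v, norm_smul_inv_norm hv0, fun i => ?_⟩
  have : inner ℝ (w i) v = 0 := congrFun (LinearMap.mem_ker.1 hv) i
  rw [inner_smul_left, real_inner_comm, this, mul_zero]

/-- The constant quantifying general position of the vectors attached to the cells. -/
def sepConst : ℝ := (1 / 8) ^ Fintype.card (Fin 4 → Fin 9 × Fin 9 × Fin 9)

theorem sepConst_pos : 0 < sepConst := by unfold sepConst; positivity

theorem sepConst_le_one : sepConst ≤ 1 := pow_le_one₀ (by norm_num) (by norm_num)

/-- The vector `a j c` is far from every span of the frame `B j c` and of vectors of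
the previous families attached to neighbours of the cell `c`. -/
def IsSeparated {k : ℕ} (B : Fin 4 → ℤ × ℤ × ℤ → Fin k → V) (a : Fin 4 → ℤ × ℤ × ℤ → V)
    (j : Fin 4) : Prop :=
  ∀ c, ‖a j c‖ ≤ 1 ∧ ∀ o : Fin 4 → Fin 9 × Fin 9 × Fin 9, ∃ n : V, ‖n‖ = 1 ∧
    (∀ i, inner ℝ n (B j c i) = 0) ∧ (∀ i < j, inner ℝ n (a i (cellShift c (o i))) = 0) ∧
    sepConst ≤ |inner ℝ n (a j c)|

theorem exists_isSeparated [FiniteDimensional ℝ V] {k : ℕ} (hk : k + 4 ≤ Module.finrank ℝ V)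
    (B : Fin 4 → ℤ × ℤ × ℤ → Fin k → V) : ∃ a, ∀ j, IsSeparated B a j := by
  classical
  suffices h : ∀ m : ℕ, m ≤ 4 → ∃ a, ∀ j : Fin 4, (j : ℕ) < m → IsSeparated B a j by
    obtain ⟨a, ha⟩ := h 4 le_rfl
    exact ⟨a, fun j => ha j j.2⟩
  intro m
  induction m with
  | zero => exact fun _ => ⟨fun _ _ => 0, fun j hj => absurd hj (Nat.not_lt_zero _)⟩
  | succ m ih =>
    intro hm
    obtain ⟨a, ha⟩ := ih (by omega)
    let J : Fin 4 := ⟨m, by omega⟩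
    have hn (c : ℤ × ℤ × ℤ) (o : Fin 4 → Fin 9 × Fin 9 × Fin 9) : ∃ n : V, ‖n‖ = 1 ∧
        (∀ i, inner ℝ n (B J c i) = 0) ∧
        ∀ i < J, inner ℝ n (a i (cellShift c (o i))) = 0 := by
      obtain ⟨n, hn, hn'⟩ := exists_norm_eq_one_inner_eq_zero
        (Sum.elim (B J c) fun i : Fin m =>
          a (i.castLE (by omega)) (cellShift c (o (i.castLE (by omega)))))
        (by simp; omega)
      exact ⟨n, hn, fun i => hn' (Sum.inl i), fun i hi => hn' (Sum.inr ⟨i, hi⟩)⟩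
    choose n hn1 hnB hna using hn
    have hb (c : ℤ × ℤ × ℤ) : ∃ b : V, ‖b‖ ≤ 1 ∧ ∀ o, sepConst ≤ |inner ℝ (n c o) b| :=
      exists_pow_card_le_abs_inner (n c) (hn1 c)
    choose b hb1 hb using hb
    have hne {i : Fin 4} (hi : i < J) : Function.update a J b i = a i :=
      Function.update_of_ne hi.ne _ _
    refine ⟨Function.update a J b, fun j hj => ?_⟩
    rcases Nat.lt_succ_iff_lt_or_eq.1 hj with hj | hj
    · have hjJ : j < J := hj
      intro c
      rw [hne hjJ]
      refine ⟨(ha j hj c).1, fun o => ?_⟩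
      obtain ⟨ν, h1, h2, h3, h4⟩ := (ha j hj c).2 o
      exact ⟨ν, h1, h2, fun i hi => by rw [hne (hi.trans hjJ)]; exact h3 i hi, h4⟩
    · obtain rfl : j = J := Fin.ext hj
      intro c
      rw [Function.update_self]
      exact ⟨hb1 c, fun o => ⟨n c o, hn1 c o, hnB c o,
        fun i hi => by rw [hne hi]; exact hna c o i hi, hb c o⟩⟩

theorem mul_le_norm_add {a T : V} {κ e t : ℝ} {n : V} (ht : 0 ≤ t) (hn : ‖n‖ = 1)
    (ha : κ ≤ |inner ℝ n a|) (hT : |inner ℝ n T - t * inner ℝ n a| ≤ e) :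
    κ * t ≤ ‖T‖ + e := by
  have h1 := abs_real_inner_le_norm n T
  rw [hn, one_mul] at h1
  have h2 := abs_sub_abs_le_abs_sub (t * inner ℝ n a) (inner ℝ n T)
  rw [abs_sub_comm, abs_mul, abs_of_nonneg ht] at h2
  nlinarith

theorem pow_mul_le_norm_sub_sum {k : ℕ} {f : Fin k → V} (hf : ∀ i, ‖f i‖ ≤ 1)
    {B : Fin 4 → Fin k → V} {ε : ℝ} (hB : ∀ j i, ‖B j i - f i‖ ≤ ε)
    {a n : Fin 4 → V} {t : Fin 4 → ℝ} (ha : ∀ j, ‖a j‖ ≤ 1) (ht : ∀ j, 0 ≤ t j)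
    (ht1 : ∀ j, t j ≤ 1) (hn : ∀ j, ‖n j‖ = 1) (hnB : ∀ j i, inner ℝ (n j) (B j i) = 0)
    (hna : ∀ j, ∀ i < j, inner ℝ (n j) (a i) = 0) {κ : ℝ} (hκ0 : 0 ≤ κ) (hκ1 : κ ≤ 1)
    (hκ : ∀ j, κ ≤ |inner ℝ (n j) (a j)|) (j : Fin 4) :
    κ ^ 4 * t j ≤ 8 * (‖∑ l, t l • a l - ∑ i, inner ℝ (f i) (∑ l, t l • a l) • f i‖ +
      4 * k * ε) := by
  set S := ∑ l, t l • a l with hS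
  have hta (l : Fin 4) : ‖t l • a l‖ ≤ t l := by
    rw [norm_smul, Real.norm_of_nonneg (ht l)]
    exact mul_le_of_le_one_right (ht l) (ha l)
  have hS4 : ‖S‖ ≤ 4 := by
    refine (norm_sum_le_of_le _ fun l _ => (hta l).trans (ht1 l)).trans (by simp)
  set R := ∑ i, inner ℝ (f i) S • f i with hR
  have hnR (j : Fin 4) : |inner ℝ (n j) R| ≤ 4 * k * ε := by
    rw [hR, inner_sum]
    have h (i : Fin k) : |inner ℝ (n j) (inner ℝ (f i) S • f i)| ≤ 4 * ε := by
      rw [inner_smul_right, abs_mul]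
      have h1 : |inner ℝ (f i) S| ≤ 4 := by
        refine (abs_real_inner_le_norm _ _).trans ?_
        nlinarith [hf i, norm_nonneg (f i), norm_nonneg S]
      have h2 : |inner ℝ (n j) (f i)| ≤ ε := by
        have := abs_real_inner_le_norm (n j) (B j i - f i)
        rw [inner_sub_right, hnB, zero_sub, abs_neg, hn, one_mul] at this
        exact this.trans (hB j i)
      exact mul_le_mul h1 h2 (abs_nonneg _) (by norm_num)
    refine (Finset.abs_sum_le_sum_abs _ _).trans ((Finset.sum_le_sum fun i _ => h i).trans ?_)
    simp only [Finset.sum_const, Finset.card_univ, Fintype.card_fin, nsmul_eq_mul]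
    linarith
  set e := 4 * k * ε with he
  have hS' : S = t 0 • a 0 + t 1 • a 1 + t 2 • a 2 + t 3 • a 3 := by
    rw [hS, Fin.sum_univ_four]
  have e3 : κ * t 3 ≤ ‖S - R‖ + e := by
    refine mul_le_norm_add (ht 3) (hn 3) (hκ 3) ?_
    rw [hS']
    simp only [inner_sub_right, inner_add_right, inner_smul_right,
      hna 3 0 (by decide), hna 3 1 (by decide), hna 3 2 (by decide)]
    convert hnR 3 using 1
    rw [← abs_neg]
    congr 1
    ring
  have e2 : κ * t 2 ≤ ‖S - R - t 3 • a 3‖ + e := by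
    refine mul_le_norm_add (ht 2) (hn 2) (hκ 2) ?_
    rw [hS']
    simp only [inner_sub_right, inner_add_right, inner_smul_right,
      hna 2 0 (by decide), hna 2 1 (by decide)]
    convert hnR 2 using 1
    rw [← abs_neg]
    congr 1
    ring
  have e1 : κ * t 1 ≤ ‖S - R - t 3 • a 3 - t 2 • a 2‖ + e := by
    refine mul_le_norm_add (ht 1) (hn 1) (hκ 1) ?_
    rw [hS']
    simp only [inner_sub_right, inner_add_right, inner_smul_right, hna 1 0 (by decide)]
    convert hnR 1 using 1
    rw [← abs_neg]
    congr 1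
    ring
  have e0 : κ * t 0 ≤ ‖S - R - t 3 • a 3 - t 2 • a 2 - t 1 • a 1‖ + e := by
    refine mul_le_norm_add (ht 0) (hn 0) (hκ 0) ?_
    rw [hS']
    simp only [inner_sub_right, inner_add_right, inner_smul_right]
    convert hnR 0 using 1
    rw [← abs_neg]
    congr 1
    ring
  have n2 := (norm_sub_le (S - R) (t 3 • a 3)).trans (add_le_add_right (hta 3) _)
  have n1 := (norm_sub_le (S - R - t 3 • a 3) (t 2 • a 2)).trans (add_le_add_right (hta 2) _)
  have n0 := (norm_sub_le (S - R - t 3 • a 3 - t 2 • a 2) (t 1 • a 1)).trans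
    (add_le_add_right (hta 1) _)
  have he0 : 0 ≤ e := (abs_nonneg _).trans (hnR 0)
  have hr0 := norm_nonneg (S - R)
  set u := ‖S - R‖ + e with hu
  have hu0 : 0 ≤ u := add_nonneg hr0 he0
  have d2 : κ * t 2 ≤ u + t 3 := by linarith
  have d1 : κ * t 1 ≤ u + t 3 + t 2 := by linarith
  have d0 : κ * t 0 ≤ u + t 3 + t 2 + t 1 := by linarith
  have k0 := ht 0
  have k1 := ht 1
  have k2 := ht 2
  have k3 := ht 3
  have le_of {x : ℝ} (hx : 0 ≤ x) : κ * x ≤ x := mul_le_of_le_one_left hx hκ1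
  have m {x y : ℝ} (h : x ≤ y) : κ * x ≤ κ * y := mul_le_mul_of_nonneg_left h hκ0
  have f2 : κ * (κ * t 2) ≤ 2 * u := by
    linarith [m d2, le_of hu0]
  have f1 : κ * (κ * (κ * t 1)) ≤ 4 * u := by
    linarith [m (m d1), le_of hu0, m (le_of hu0), m e3]
  have f0 : κ * (κ * (κ * (κ * t 0))) ≤ 8 * u := by
    linarith [m (m (m d0)), le_of hu0, m (le_of hu0), m (m (le_of hu0)), m e3, m (m e3), m f2]
  rw [show κ ^ 4 * t j = κ * (κ * (κ * (κ * t j))) by ring]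
  fin_cases j
  · exact f0
  · change κ * (κ * (κ * (κ * t 1))) ≤ _
    linarith [m f1, le_of hu0]
  · change κ * (κ * (κ * (κ * t 2))) ≤ _
    linarith [m (m f2), m (le_of hu0), le_of hu0]
  · change κ * (κ * (κ * (κ * t 3))) ≤ _
    linarith [m (m (m e3)), m (m (le_of hu0)), m (le_of hu0), le_of hu0]

end GeneralPosition

/-! ### The lift -/

/-- The sum of the vectors `a j c` weighted by the cell weights. -/
def cellSum {V : Type*} [NormedAddCommGroup V] [NormedSpace ℝ V]
    (a : Fin 4 → ℤ × ℤ × ℤ → V) (p : H) : V :=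
  ∑ j : Fin 4, cellWeight j p • a j (cellIndex j p)

section CellSum

variable {V : Type*} [NormedAddCommGroup V] [NormedSpace ℝ V] {a : Fin 4 → ℤ × ℤ × ℤ → V}

theorem norm_cellSum_le (ha : ∀ j c, ‖a j c‖ ≤ 1) (p : H) : ‖cellSum a p‖ ≤ 4 := by
  have h (j : Fin 4) : ‖cellWeight j p • a j (cellIndex j p)‖ ≤ 1 := by
    rw [norm_smul, Real.norm_of_nonneg (cellWeight_nonneg _ _)]
    exact mul_le_one₀ (cellWeight_le_one _ _) (norm_nonneg _) (ha _ _)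
  exact (norm_sum_le_of_le _ fun j _ => h j).trans (by simp)

theorem norm_cellSum_sub_le (ha : ∀ j c, ‖a j c‖ ≤ 1) {s : ℝ} (hs : s ≤ 1 / 192) {p q : H}
    (h : IsNear s p q) : ‖cellSum a q - cellSum a p‖ ≤ 12 * s := by
  have hs0 : 0 ≤ s := (abs_nonneg _).trans h.1
  have key (j : Fin 4) : ‖cellWeight j q • a j (cellIndex j q) -
      cellWeight j p • a j (cellIndex j p)‖ ≤ 3 * s := by
    rcases cellIndex_eq_or_cellWeight_eq_zero hs h j.2 with ⟨h1, h2⟩ | ⟨h1, h2⟩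
    · rw [h1, ← sub_smul, norm_smul, Real.norm_eq_abs]
      exact (mul_le_of_le_one_right (abs_nonneg _) (ha _ _)).trans h2
    · simp [h1, h2, hs0]
  unfold cellSum
  rw [← Finset.sum_sub_distrib]
  refine (norm_sum_le_of_le _ fun j _ => key j).trans ?_
  simp only [Finset.sum_const, Finset.card_univ, Fintype.card_fin, nsmul_eq_mul]
  push_cast
  linarith

theorem continuous_cellSum (ha : ∀ j c, ‖a j c‖ ≤ 1) : Continuous (cellSum a) := by
  refine continuous_iff_continuousAt.2 fun p => ?_
  let s : H → ℝ := fun q =>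
    |q.1 - p.1| + |q.2.1 - p.2.1| + |q.2.2 - p.2.2 - p.2.1 * (q.1 - p.1)|
  have hs : Filter.Tendsto s (nhds p) (nhds 0) := by
    have hc : Continuous s := by
      simp only [s]
      fun_prop
    convert hc.tendsto p using 2
    simp [s]
  rw [ContinuousAt, tendsto_iff_norm_sub_tendsto_zero]
  have hs' : Filter.Tendsto (fun q => 12 * s q) (nhds p) (nhds 0) := by
    simpa using hs.const_mul 12
  refine squeeze_zero' (Filter.Eventually.of_forall fun _ => norm_nonneg _) ?_ hs'
  filter_upwards [hs.eventually (Iic_mem_nhds (show (0 : ℝ) < 1 / 192 by norm_num))] with q hq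
  have h1 := abs_nonneg (q.1 - p.1)
  have h2 := abs_nonneg (q.2.1 - p.2.1)
  have h3 := abs_nonneg (q.2.2 - p.2.2 - p.2.1 * (q.1 - p.1))
  exact norm_cellSum_sub_le ha hq
    ⟨by simp only [s]; linarith, by simp only [s]; linarith, by simp only [s]; linarith⟩

end CellSum

/-- The component of `x.2` orthogonal to the orthonormal family `x.1`. -/
def frameResidual {V : Type*} [NormedAddCommGroup V] [InnerProductSpace ℝ V] {k : ℕ}
    (x : (Fin k → V) × V) : V :=
  x.2 - ∑ i, inner ℝ (x.1 i) x.2 • x.1 i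

section FrameResidual

variable {V : Type*} [NormedAddCommGroup V] [InnerProductSpace ℝ V] {k : ℕ}

theorem continuous_frameResidual : Continuous (frameResidual : (Fin k → V) × V → V) := by
  unfold frameResidual
  fun_prop

theorem inner_frameResidual {f : Fin k → V} (hf : Orthonormal ℝ f) (S : V) (i : Fin k) :
    inner ℝ (f i) (frameResidual (f, S)) = 0 := by
  simp only [frameResidual, inner_sub_right]
  rw [hf.inner_right_fintype, sub_self]

theorem orthonormal_snoc {f : Fin k → V} (hf : Orthonormal ℝ f) {v : V} (hv : ‖v‖ = 1)
    (hfv : ∀ i, inner ℝ (f i) v = 0) : Orthonormal ℝ (Fin.snoc f v : Fin (k + 1) → V) := by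
  refine ⟨fun i => ?_, fun i j hij => ?_⟩
  · refine Fin.lastCases ?_ (fun i => ?_) i
    · simpa using hv
    · simpa using hf.1 i
  · revert hij
    refine Fin.lastCases ?_ (fun i => ?_) i <;> refine Fin.lastCases ?_ (fun j => ?_) j
    · simp
    · intro _
      simpa [real_inner_comm] using hfv j
    · intro _
      simpa using hfv i
    · intro hij
      simpa using hf.2 fun h => hij (congrArg Fin.castSucc h)

theorem orthonormal_snoc_frameResidual {f : Fin k → V} (hf : Orthonormal ℝ f) {S : V}
    (hS : frameResidual (f, S) ≠ 0) :
    Orthonormal ℝ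
      (Fin.snoc f (‖frameResidual (f, S)‖⁻¹ • frameResidual (f, S)) : Fin (k + 1) → V) :=
  orthonormal_snoc hf (norm_smul_inv_norm hS) fun i => by
    rw [inner_smul_right, inner_frameResidual hf, mul_zero]

theorem uniformContinuousOn_normalize_frameResidual [FiniteDimensional ℝ V] {c₀ : ℝ}
    (hc₀ : 0 < c₀) :
    UniformContinuousOn (fun x : (Fin k → V) × V => ‖frameResidual x‖⁻¹ • frameResidual x)
      {x | (∀ i, ‖x.1 i‖ ≤ 1) ∧ ‖x.2‖ ≤ 4 ∧ c₀ ≤ ‖frameResidual x‖} := by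
  have hρ := continuous_frameResidual (V := V) (k := k)
  refine IsCompact.uniformContinuousOn_of_continuous ?_ ?_
  · refine (isCompact_closedBall (0 : (Fin k → V) × V) 4).of_isClosed_subset ?_ ?_
    · have h1 : IsClosed {x : (Fin k → V) × V | ∀ i, ‖x.1 i‖ ≤ 1} := by
        rw [show {x : (Fin k → V) × V | ∀ i, ‖x.1 i‖ ≤ 1} = ⋂ i, {x | ‖x.1 i‖ ≤ 1} by ext; simp]
        exact isClosed_iInter fun i => isClosed_le (by fun_prop) continuous_const
      have h2 : IsClosed {x : (Fin k → V) × V | ‖x.2‖ ≤ 4} :=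
        isClosed_le (by fun_prop) continuous_const
      exact h1.inter (h2.inter (isClosed_le continuous_const hρ.norm))
    · rintro x ⟨h1, h2, -⟩
      rw [mem_closedBall_zero_iff]
      refine max_le ((pi_norm_le_iff_of_nonneg (by norm_num)).2 fun i => ?_) h2
      exact (h1 i).trans (by norm_num)
  · exact ContinuousOn.smul (hρ.norm.continuousOn.inv₀ fun x hx => (hc₀.trans_le hx.2.2).ne')
      hρ.continuousOn

end FrameResidual

theorem exists_section {V : Type*} [NormedAddCommGroup V] [InnerProductSpace ℝ V]
    [FiniteDimensional ℝ V] {k : ℕ} (hk : k + 4 ≤ Module.finrank ℝ V) {c ε : ℝ} (hc : 0 < c)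
    (hε : 4 * k * ε ≤ sepConst ^ 4 / 1024) {f : H → Fin k → V} (hf : ∀ p, Orthonormal ℝ (f p))
    (hfε : ∀ p q, ccDist p q < c * 10 → ∀ i, ‖f q i - f p i‖ ≤ ε) :
    ∃ S : H → V, Continuous S ∧ (∀ p, ‖S p‖ ≤ 4) ∧
      (∀ s ≤ 1 / 192, ∀ p q, ccDist p q < c * s → ‖S q - S p‖ ≤ 12 * s) ∧
      ∀ p, sepConst ^ 4 / 1024 ≤ ‖frameResidual (f p, S p)‖ := by
  obtain ⟨a, ha⟩ := exists_isSeparated hk fun j c' => f (dilate c (cellBase j c'))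
  have ha1 (j : Fin 4) (c' : ℤ × ℤ × ℤ) : ‖a j c'‖ ≤ 1 := (ha j c').1
  refine ⟨fun p => cellSum a (dilate c⁻¹ p), (continuous_cellSum ha1).comp ?_,
    fun p => norm_cellSum_le ha1 _, fun s hs p q hpq => norm_cellSum_sub_le ha1 hs
      (isNear_dilate_of_ccDist_lt hc (hs.trans (by norm_num)) hpq), fun p => ?_⟩
  · unfold dilate
    fun_prop
  set P := dilate c⁻¹ p with hP
  have hn (j : Fin 4) : ∃ n : V, ‖n‖ = 1 ∧
      (∀ i, inner ℝ n (f (dilate c (cellBase j (cellIndex j P))) i) = 0) ∧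
      (∀ i < j, inner ℝ n (a i (cellIndex i P)) = 0) ∧
      sepConst ≤ |inner ℝ n (a j (cellIndex j P))| := by
    choose o ho using fun i : Fin 4 => exists_cellIndex_eq_cellShift i.2 j.2 P
    obtain ⟨n, h1, h2, h3, h4⟩ := (ha j (cellIndex j P)).2 o
    exact ⟨n, h1, h2, fun i hi => by rw [ho]; exact h3 i hi, h4⟩
  choose n hn1 hnB hna hκ using hn
  obtain ⟨j, hj⟩ := exists_le_cellWeight P
  have hclose (j : Fin 4) (i : Fin k) :
      ‖f (dilate c (cellBase j (cellIndex j P))) i - f p i‖ ≤ ε :=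
    hfε _ _ ((ccDist_dilate_cellBase_le hc j.2 p).trans_lt (by linarith)) i
  have h := pow_mul_le_norm_sub_sum (fun i => ((hf p).1 i).le) hclose
    (fun j => ha1 j (cellIndex j P)) (fun j => cellWeight_nonneg j P)
    (fun j => cellWeight_le_one j P) hn1 hnB hna sepConst_pos.le sepConst_le_one hκ j
  change _ ≤ 8 * (‖frameResidual (f p, cellSum a P)‖ + _) at h
  have hκ4 : 0 < sepConst ^ 4 := pow_pos sepConst_pos 4
  have := mul_le_mul_of_nonneg_left hj hκ4.le
  linarith

theorem norm_sub_le_tupleDist {k D : ℕ} (v w : Fin k → EuclideanSpace ℝ (Fin D)) (i : Fin k) :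
    ‖v i - w i‖ ≤ tupleDist v w := by
  refine Real.le_sqrt_of_sq_le ?_
  exact Finset.single_le_sum (f := fun i => ‖v i - w i‖ ^ 2) (fun _ _ => by positivity)
    (Finset.mem_univ i)

theorem tupleDist_snoc_le {k D : ℕ} (v w : Fin k → EuclideanSpace ℝ (Fin D))
    (x y : EuclideanSpace ℝ (Fin D)) :
    tupleDist (Fin.snoc v x : Fin (k + 1) → _) (Fin.snoc w y : Fin (k + 1) → _) ≤
      tupleDist v w + ‖x - y‖ := by
  have h0 : 0 ≤ tupleDist v w := Real.sqrt_nonneg _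
  have h1 : tupleDist v w ^ 2 = ∑ i, ‖v i - w i‖ ^ 2 :=
    Real.sq_sqrt (Finset.sum_nonneg fun _ _ => by positivity)
  refine Real.sqrt_le_iff.2 ⟨by positivity, ?_⟩
  rw [Fin.sum_univ_castSucc]
  simp only [Fin.snoc_castSucc, Fin.snoc_last]
  rw [← h1]
  nlinarith [norm_nonneg (x - y)]

/-- **Uniform lifting** (Proposition 7.2 of the paper): if `1 ≤ k ≤ D - 4`, any uniformly
equicontinuous family of continuous maps `H → V_{k,D}` (with respect to the
Carnot–Carathéodory metric) lifts to a uniformly equicontinuous family of continuous maps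
`H → V_{k+1,D}`. -/
theorem statement7 (D k : ℕ) (hk : 1 ≤ k) (hkD : k + 4 ≤ D)
    (F : Set (H → Stiefel k D))
    (hcont : ∀ f ∈ F, Continuous f)
    (hequi : ∀ η : ℝ, 0 < η → ∃ δ : ℝ, 0 < δ ∧
      ∀ f ∈ F, ∀ p q : H, ccDist p q < δ → tupleDist (f p).1 (f q).1 < η) :
    ∃ Ft : Set (H → Stiefel (k + 1) D),
      (∀ g ∈ Ft, Continuous g) ∧
      (∀ η : ℝ, 0 < η → ∃ δ : ℝ, 0 < δ ∧
        ∀ g ∈ Ft, ∀ p q : H, ccDist p q < δ → tupleDist (g p).1 (g q).1 < η) ∧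
      ∀ f ∈ F, ∃ g ∈ Ft, ∀ p : H, stiefelProj (g p) = f p := by
  set c₀ : ℝ := sepConst ^ 4 / 1024 with hc₀
  have hc₀0 : 0 < c₀ := div_pos (pow_pos sepConst_pos 4) (by norm_num)
  have hk0 : (0 : ℝ) < 4 * k := by positivity
  obtain ⟨δ₀, hδ₀, hfδ⟩ := hequi (c₀ / (4 * k)) (div_pos hc₀0 hk0)
  obtain ⟨c, hc, hcδ⟩ : ∃ c : ℝ, 0 < c ∧ c * 10 = δ₀ := ⟨δ₀ / 10, by positivity, by ring⟩
  have hS (f : F) := exists_section (V := EuclideanSpace ℝ (Fin D)) (by simpa using hkD) hc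
    (mul_div_cancel₀ c₀ hk0.ne').le (f := fun p => (f.1 p).1) (fun p => (f.1 p).2)
    (fun p q hpq i => by
      rw [norm_sub_rev]
      exact (norm_sub_le_tupleDist _ _ i).trans (hfδ f.1 f.2 p q (hcδ ▸ hpq)).le)
  choose S hScont hS4 hSu hSc using hS
  have hne (f : F) (p : H) : frameResidual ((f.1 p).1, S f p) ≠ 0 :=
    norm_pos_iff.1 (hc₀0.trans_le (hSc f p))
  let g : F → H → Stiefel (k + 1) D := fun f p =>
    ⟨_, orthonormal_snoc_frameResidual (f.1 p).2 (hne f p)⟩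
  refine ⟨Set.range g, ?_, ?_, fun f hf => ⟨g ⟨f, hf⟩, ⟨_, rfl⟩, fun p => ?_⟩⟩
  · rintro _ ⟨f, rfl⟩
    have hf : Continuous fun p => (f.1 p).1 := continuous_subtype_val.comp (hcont f.1 f.2)
    have hr : Continuous fun p => frameResidual ((f.1 p).1, S f p) :=
      continuous_frameResidual.comp (hf.prodMk (hScont f))
    refine Continuous.subtype_mk (continuous_pi fun i => ?_) _
    refine Fin.lastCases ?_ (fun i => ?_) i
    · simp only [Fin.snoc_last]
      exact (hr.norm.inv₀ fun p => norm_ne_zero_iff.2 (hne f p)).smul hr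
    · simp only [Fin.snoc_castSucc]
      exact (continuous_apply i).comp hf
  · intro η hη
    obtain ⟨θ, hθ, hΦ⟩ := Metric.uniformContinuousOn_iff.1
      (uniformContinuousOn_normalize_frameResidual (V := EuclideanSpace ℝ (Fin D)) (k := k) hc₀0)
      (η / 2) (by positivity)
    obtain ⟨δ₁, hδ₁, h₁⟩ := hequi (min θ (η / 2)) (by positivity)
    set s := min (1 / 192) (θ / 24) with hs
    have hs0 : 0 < s := by positivity
    refine ⟨min δ₁ (c * s), by positivity, ?_⟩
    rintro _ ⟨f, rfl⟩ p q hpq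
    have hfpq := h₁ f.1 f.2 p q (hpq.trans_le (min_le_left _ _))
    have hSpq := hSu f s (min_le_left _ _) p q (hpq.trans_le (min_le_right _ _))
    have hmem (p : H) : ((f.1 p).1, S f p) ∈ {x : (Fin k → EuclideanSpace ℝ (Fin D)) × _ |
        (∀ i, ‖x.1 i‖ ≤ 1) ∧ ‖x.2‖ ≤ 4 ∧ c₀ ≤ ‖frameResidual x‖} :=
      ⟨fun i => ((f.1 p).2.1 i).le, hS4 f p, hSc f p⟩
    have hdist : dist ((f.1 p).1, S f p) ((f.1 q).1, S f q) < θ := by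
      refine max_lt ((dist_pi_lt_iff hθ).2 fun i => ?_) ?_
      · rw [dist_eq_norm]
        exact (norm_sub_le_tupleDist _ _ i).trans_lt (hfpq.trans_le (min_le_left _ _))
      · rw [dist_comm, dist_eq_norm]
        have := min_le_right (1 / 192) (θ / 24)
        linarith
    have h := hΦ _ (hmem p) _ (hmem q) hdist
    rw [dist_eq_norm] at h
    refine (tupleDist_snoc_le _ _ _ _).trans_lt ?_
    linarith [min_le_right θ (η / 2)]
  · refine Subtype.ext (funext fun i => ?_)
    simp only [stiefelProj, g, Fin.snoc_castSucc]
end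
end

section
/- Let D and k be integers with 1 ≤ k ≤ D − 4 and let j ≥ 1 be an integer. There is a constant C(D,j) with the following property: for any 0 < K < 1 and any smooth maps v₁,…,v_k: H → S^{D−1} (the unit sphere of ℝ^D) with ‖∇v_i‖_{C^j} ≤ K for i = 1,…,k and such that v₁(p),…,v_k(p) form an orthonormal system in ℝ^D for every p ∈ H, there exists a smooth map v_{k+1}: H → S^{D−1} with ‖∇v_{k+1}‖_{C^j} ≤ C(D,j)·K such that for every p ∈ H the vector v_{k+1}(p) is orthogonal to each of v₁(p),…,v_k(p). -/
open scoped ENNReal NNReal RealInnerProductSpace BigOperators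

noncomputable section

open Heisenberg
open scoped RealInnerProductSpace

namespace Heisenberg

variable {E : Type*} [NormedAddCommGroup E] [NormedSpace ℝ E]

/-- The value at `p` of the horizontal vector field `X` or `Y`. -/
def horizontalVec (b : Bool) (p : H) : H := if b then (1, 0, p.2.1) else (0, 1, 0)

/-- The iterated horizontal derivative of `φ` along a word in `X`, `Y`. -/
def word (l : List Bool) (φ : H → E) : H → E := l.foldr WD φ

lemma WD_apply (b : Bool) (φ : H → E) (p : H) :
    WD b φ p = fderiv ℝ φ p (horizontalVec b p) := by
  cases b <;> rfl

lemma contDiff_horizontalVec (b : Bool) : ContDiff ℝ (⊤ : ℕ∞) (horizontalVec b) := by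
  cases b
  · exact contDiff_const
  · change ContDiff ℝ (⊤ : ℕ∞) fun p : H => ((1, 0, p.2.1) : H)
    fun_prop

lemma contDiff_WD (b : Bool) {φ : H → E} (hφ : ContDiff ℝ (⊤ : ℕ∞) φ) :
    ContDiff ℝ (⊤ : ℕ∞) (WD b φ) := by
  have : WD b φ = fun p => fderiv ℝ φ p (horizontalVec b p) := funext (WD_apply b φ)
  rw [this]
  exact (hφ.fderiv_right (m := (⊤ : ℕ∞)) (by simp)).clm_apply (contDiff_horizontalVec b)

@[simp] lemma word_nil (φ : H → E) : word [] φ = φ := rfl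

lemma word_cons (b : Bool) (l : List Bool) (φ : H → E) :
    word (b :: l) φ = WD b (word l φ) := rfl

lemma word_append_singleton (l : List Bool) (b : Bool) (φ : H → E) :
    word (l ++ [b]) φ = word l (WD b φ) := by
  simp [word]

lemma contDiff_word (l : List Bool) {φ : H → E} (hφ : ContDiff ℝ (⊤ : ℕ∞) φ) :
    ContDiff ℝ (⊤ : ℕ∞) (word l φ) := by
  induction l with
  | nil => exact hφ
  | cons b l ih => exact contDiff_WD b ih

lemma ContDiff.differentiableAt_top {φ : H → E} (hφ : ContDiff ℝ (⊤ : ℕ∞) φ) (p : H) :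
    DifferentiableAt ℝ φ p :=
  (hφ.differentiable (by simp)).differentiableAt

lemma word_eventuallyEq (l : List Bool) {f g : H → E} {p : H} (h : f =ᶠ[nhds p] g) :
    word l f =ᶠ[nhds p] word l g := by
  induction l with
  | nil => exact h
  | cons b l ih =>
    filter_upwards [ih.fderiv (𝕜 := ℝ)] with q hq
    rw [word_cons, word_cons, WD_apply, WD_apply, hq]

lemma WD_const_smul (b : Bool) (c : ℝ) {φ : H → E} (hφ : ContDiff ℝ (⊤ : ℕ∞) φ) :
    WD b (fun p => c • φ p) = fun p => c • WD b φ p := by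
  funext p
  rw [WD_apply, WD_apply, fderiv_fun_const_smul (hφ.differentiableAt_top p)]
  rfl

lemma word_const_smul (l : List Bool) (c : ℝ) {φ : H → E} (hφ : ContDiff ℝ (⊤ : ℕ∞) φ) :
    word l (fun p => c • φ p) = fun p => c • word l φ p := by
  induction l with
  | nil => rfl
  | cons b l ih => rw [word_cons, ih, WD_const_smul b c (contDiff_word l hφ)]; rfl

lemma word_sum_smul {ι : Type*} (T : Finset ι) (l : List Bool) {φ : ι → H → ℝ} (a : ι → E)
    (hφ : ∀ i, ContDiff ℝ (⊤ : ℕ∞) (φ i)) :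
    word l (fun p => ∑ i ∈ T, φ i p • a i) = fun p => ∑ i ∈ T, word l (φ i) p • a i := by
  induction l with
  | nil => rfl
  | cons b l ih =>
    funext p
    have hd : ∀ i, DifferentiableAt ℝ (word l (φ i)) p := fun i =>
      (contDiff_word l (hφ i)).differentiableAt_top p
    rw [word_cons, ih, WD_apply, fderiv_fun_sum fun i _ => (hd i).smul_const _]
    simp only [sum_apply, word_cons, WD_apply]
    refine Finset.sum_congr rfl fun i _ => ?_
    rw [fderiv_smul_const (hd i)]
    rfl

lemma WD_prodMk {E' : Type*} [NormedAddCommGroup E'] [NormedSpace ℝ E'] (b : Bool)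
    {f : H → E} {g : H → E'} (hf : ContDiff ℝ (⊤ : ℕ∞) f) (hg : ContDiff ℝ (⊤ : ℕ∞) g) :
    WD b (fun p => (f p, g p)) = fun p => (WD b f p, WD b g p) := by
  funext p
  rw [WD_apply, WD_apply, WD_apply,
    (hf.differentiableAt_top p).fderiv_prodMk (hg.differentiableAt_top p)]
  rfl

lemma word_prodMk {E' : Type*} [NormedAddCommGroup E'] [NormedSpace ℝ E'] (l : List Bool)
    {f : H → E} {g : H → E'} (hf : ContDiff ℝ (⊤ : ℕ∞) f) (hg : ContDiff ℝ (⊤ : ℕ∞) g) :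
    word l (fun p => (f p, g p)) = fun p => (word l f p, word l g p) := by
  induction l with
  | nil => rfl
  | cons b l ih =>
    rw [word_cons, ih, WD_prodMk b (contDiff_word l hf) (contDiff_word l hg)]; rfl

lemma word_pi {k : ℕ} (l : List Bool) {f : Fin k → H → E}
    (hf : ∀ i, ContDiff ℝ (⊤ : ℕ∞) (f i)) :
    word l (fun p i => f i p) = fun p i => word l (f i) p := by
  induction l with
  | nil => rfl
  | cons b l ih =>
    funext p i
    rw [word_cons, ih, WD_apply,
      fderiv_pi fun i => (contDiff_word l (hf i)).differentiableAt_top p, word_cons, WD_apply]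
    rfl

/-! ### Right translations and dilations -/

/-- Right translation `p ↦ p · γ⁻¹`. -/
def rightTranslate (γ p : H) : H := mul p (inv γ)

lemma rightTranslate_eq (γ p : H) :
    rightTranslate γ p = (p.1 - γ.1, p.2.1 - γ.2.1, p.2.2 - γ.2.2 - (p.1 - γ.1) * γ.2.1) := by
  simp only [rightTranslate, mul, inv, Prod.mk.injEq]
  refine ⟨by ring, by ring, by ring⟩

lemma contDiff_rightTranslate (γ : H) : ContDiff ℝ (⊤ : ℕ∞) (rightTranslate γ) := by
  rw [funext (rightTranslate_eq γ)]
  fun_prop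

lemma fderiv_rightTranslate (γ p : H) (b : Bool) :
    fderiv ℝ (rightTranslate γ) p (horizontalVec b p) =
      horizontalVec b (rightTranslate γ p) := by
  have h : HasFDerivAt (rightTranslate γ)
      ((ContinuousLinearMap.fst ℝ ℝ (ℝ × ℝ)).prod
        (((ContinuousLinearMap.fst ℝ ℝ ℝ).comp (ContinuousLinearMap.snd ℝ ℝ (ℝ × ℝ))).prod
          ((ContinuousLinearMap.snd ℝ ℝ ℝ).comp (ContinuousLinearMap.snd ℝ ℝ (ℝ × ℝ)) -
            γ.2.1 • ContinuousLinearMap.fst ℝ ℝ (ℝ × ℝ)))) p := by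
    rw [funext (rightTranslate_eq γ)]
    refine (hasFDerivAt_fst.sub_const _).prodMk
      ((hasFDerivAt_snd.fst.sub_const _).prodMk
        ((hasFDerivAt_snd.snd.sub_const _).sub ((hasFDerivAt_fst.sub_const _).mul_const _)))
  rw [h.fderiv, rightTranslate_eq]
  cases b <;> simp [horizontalVec]

lemma word_comp_rightTranslate (l : List Bool) (γ : H) {φ : H → E}
    (hφ : ContDiff ℝ (⊤ : ℕ∞) φ) :
    word l (φ ∘ rightTranslate γ) = word l φ ∘ rightTranslate γ := by
  induction l with
  | nil => rfl
  | cons b l ih =>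
    funext p
    rw [word_cons, ih, WD_apply, fderiv_comp p ((contDiff_word l hφ).differentiableAt_top _)
      ((contDiff_rightTranslate γ).differentiableAt_top p), ContinuousLinearMap.comp_apply,
      fderiv_rightTranslate, Function.comp_apply, word_cons, WD_apply]

lemma contDiff_dilate (s : ℝ) : ContDiff ℝ (⊤ : ℕ∞) (dilate s) := by
  unfold dilate
  fun_prop

lemma fderiv_dilate (s : ℝ) (p : H) (b : Bool) :
    fderiv ℝ (dilate s) p (horizontalVec b p) = s • horizontalVec b (dilate s p) := by
  have h : HasFDerivAt (dilate s)
      ((s • ContinuousLinearMap.fst ℝ ℝ (ℝ × ℝ)).prod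
        ((s • (ContinuousLinearMap.fst ℝ ℝ ℝ).comp (ContinuousLinearMap.snd ℝ ℝ (ℝ × ℝ))).prod
          (s ^ 2 • (ContinuousLinearMap.snd ℝ ℝ ℝ).comp
            (ContinuousLinearMap.snd ℝ ℝ (ℝ × ℝ))))) p :=
    (hasFDerivAt_fst.const_mul _).prodMk
      ((hasFDerivAt_snd.fst.const_mul _).prodMk (hasFDerivAt_snd.snd.const_mul _))
  rw [h.fderiv]
  cases b <;> simp [horizontalVec, dilate]
  ring

lemma word_comp_dilate (l : List Bool) (s : ℝ) {φ : H → E} (hφ : ContDiff ℝ (⊤ : ℕ∞) φ) :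
    word l (φ ∘ dilate s) = fun p => s ^ l.length • word l φ (dilate s p) := by
  induction l with
  | nil => funext p; simp
  | cons b l ih =>
    have hw := contDiff_word l hφ
    have hc : ContDiff ℝ (⊤ : ℕ∞) (fun p => word l φ (dilate s p)) :=
      hw.comp (contDiff_dilate s)
    rw [word_cons, ih, WD_const_smul b _ hc]
    funext p
    have : WD b (fun p => word l φ (dilate s p)) p = s • word (b :: l) φ (dilate s p) := by
      rw [WD_apply]
      change fderiv ℝ (word l φ ∘ dilate s) p _ = _
      rw [fderiv_comp p (hw.differentiableAt_top _)
        ((contDiff_dilate s).differentiableAt_top p), ContinuousLinearMap.comp_apply,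
        fderiv_dilate, map_smul, word_cons, WD_apply]
    rw [this, smul_smul, List.length_cons, pow_succ]

/-! ### Composition with smooth maps -/

section Composition

variable {F : Type} [NormedAddCommGroup F] [NormedSpace ℝ F]
  {G : Type} [NormedAddCommGroup G] [NormedSpace ℝ G]

lemma WD_comp {h : G → F} {U : Set G} (hU : IsOpen U) (hh : ContDiffOn ℝ (⊤ : ℕ∞) h U)
    {f : H → G} (hf : ContDiff ℝ (⊤ : ℕ∞) f) (hfU : ∀ p, f p ∈ U) (b : Bool) (p : H) :
    WD b (h ∘ f) p = fderiv ℝ h (f p) (WD b f p) := by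
  rw [WD_apply, fderiv_comp p ((hh.contDiffAt (hU.mem_nhds (hfU p))).differentiableAt (by simp))
    (hf.differentiableAt_top p), WD_apply]
  rfl

lemma contDiffOn_fderiv_apply {h : G → F} {U : Set G} (hU : IsOpen U)
    (hh : ContDiffOn ℝ (⊤ : ℕ∞) h U) :
    ContDiffOn ℝ (⊤ : ℕ∞) (fun x : G × G => fderiv ℝ h x.1 x.2) (U ×ˢ Set.univ) :=
  ((hh.fderiv_of_isOpen hU (m := (⊤ : ℕ∞)) (by simp)).comp contDiffOn_fst
    fun _ hx => hx.1).clm_apply contDiffOn_snd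

theorem exists_word_comp_le (n : ℕ) : ∀ {G : Type} [NormedAddCommGroup G] [NormedSpace ℝ G]
    [FiniteDimensional ℝ G] (h : G → F) (U S : Set G), IsOpen U → IsCompact S → S ⊆ U →
    ContDiffOn ℝ (⊤ : ℕ∞) h U → ∀ B : ℝ, ∃ C : ℝ, ∀ f : H → G, ContDiff ℝ (⊤ : ℕ∞) f →
    (∀ p, f p ∈ S) →
    (∀ l : List Bool, 1 ≤ l.length → l.length ≤ n → ∀ p, ‖word l f p‖ ≤ B) →
    ∀ l : List Bool, l.length ≤ n → ∀ p, ‖word l (h ∘ f) p‖ ≤ C := by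
  induction n with
  | zero =>
    intro G _ _ _ h U S hU hS hSU hh B
    obtain ⟨C, hC⟩ := hS.exists_bound_of_continuousOn (hh.continuousOn.mono hSU)
    refine ⟨C, fun f hf hfS _ l hl p => ?_⟩
    obtain rfl : l = [] := List.length_eq_zero_iff.mp (Nat.le_zero.mp hl)
    exact hC _ (hfS p)
  | succ n ih =>
    intro G _ _ _ h U S hU hS hSU hh B
    obtain ⟨C₀, hC₀⟩ := hS.exists_bound_of_continuousOn (hh.continuousOn.mono hSU)
    obtain ⟨C₁, hC₁⟩ := ih (fun x : G × G => fderiv ℝ h x.1 x.2) (U ×ˢ Set.univ)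
      (S ×ˢ Metric.closedBall 0 B) (hU.prod isOpen_univ) (hS.prod (isCompact_closedBall 0 B))
      (Set.prod_mono hSU (Set.subset_univ _)) (contDiffOn_fderiv_apply hU hh) B
    refine ⟨max C₀ C₁, fun f hf hfS hB l hl p => ?_⟩
    rcases List.eq_nil_or_concat' l with rfl | ⟨l, b, rfl⟩
    · exact (hC₀ _ (hfS p)).trans (le_max_left _ _)
    · have hl' : l.length ≤ n := by simpa using hl
      rw [word_append_singleton, funext (WD_comp hU hh hf (fun p => hSU (hfS p)) b)]
      refine (hC₁ (fun p => (f p, WD b f p)) (hf.prodMk (contDiff_WD b hf))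
        (fun p => ⟨hfS p, ?_⟩) (fun m hm1 hmn q => ?_) l hl' p).trans (le_max_right _ _)
      · exact mem_closedBall_zero_iff.mpr (hB [b] (by simp) (by simp) p)
      · rw [word_prodMk m hf (contDiff_WD b hf), ← word_append_singleton]
        exact max_le (hB m hm1 (by omega) q) (hB (m ++ [b]) (by simp) (by simpa using hmn) q)

/-- Composition with a smooth map preserves the smallness of the horizontal derivatives. -/
theorem exists_word_comp_le_mul [FiniteDimensional ℝ G] (n : ℕ) (h : G → F) (U S : Set G)
    (hU : IsOpen U) (hS : IsCompact S) (hSU : S ⊆ U) (hh : ContDiffOn ℝ (⊤ : ℕ∞) h U) (B : ℝ) :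
    ∃ C : ℝ, ∀ κ : ℝ, 0 < κ → κ ≤ 1 → ∀ f : H → G, ContDiff ℝ (⊤ : ℕ∞) f → (∀ p, f p ∈ S) →
    (∀ l : List Bool, 1 ≤ l.length → l.length ≤ n → ∀ p, ‖word l f p‖ ≤ B * κ) →
    ∀ l : List Bool, 1 ≤ l.length → l.length ≤ n → ∀ p, ‖word l (h ∘ f) p‖ ≤ C * κ := by
  obtain ⟨C, hC⟩ := exists_word_comp_le (n - 1) (fun x : G × G => fderiv ℝ h x.1 x.2)
    (U ×ˢ Set.univ) (S ×ˢ Metric.closedBall 0 B) (hU.prod isOpen_univ)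
    (hS.prod (isCompact_closedBall 0 B)) (Set.prod_mono hSU (Set.subset_univ _))
    (contDiffOn_fderiv_apply hU hh) B
  refine ⟨C, fun κ hκ hκ1 f hf hfS hB l hl1 hln p => ?_⟩
  rcases List.eq_nil_or_concat' l with rfl | ⟨l, b, rfl⟩
  · simp at hl1
  have hl' : l.length + 1 ≤ n := by simpa using hln
  have hw := contDiff_WD b hf
  have hw' : ContDiff ℝ (⊤ : ℕ∞) (fun p => κ⁻¹ • WD b f p) := hw.const_smul _
  have hscale : ∀ {x : ℝ}, x ≤ B * κ → κ⁻¹ * x ≤ B := fun {x} hx => by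
    rw [inv_mul_le_iff₀ hκ]; linarith
  have hg : ContDiff ℝ (⊤ : ℕ∞) (fun p => (f p, κ⁻¹ • WD b f p)) := hf.prodMk hw'
  have hgS : ∀ p, (f p, κ⁻¹ • WD b f p) ∈ S ×ˢ Metric.closedBall 0 B := fun p =>
    ⟨hfS p, mem_closedBall_zero_iff.mpr <| by
      rw [norm_smul, norm_inv, Real.norm_of_nonneg hκ.le]
      exact hscale (hB [b] (by simp) (by simp; omega) p)⟩
  have hcomp : WD b (h ∘ f) = fun p =>
      κ • ((fun x : G × G => fderiv ℝ h x.1 x.2) ∘ fun p => (f p, κ⁻¹ • WD b f p)) p := by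
    funext p
    rw [WD_comp hU hh hf (fun p => hSU (hfS p)), Function.comp_apply, map_smul,
      smul_inv_smul₀ hκ.ne']
  have hsm : ContDiff ℝ (⊤ : ℕ∞)
      ((fun x : G × G => fderiv ℝ h x.1 x.2) ∘ fun p => (f p, κ⁻¹ • WD b f p)) :=
    (contDiffOn_fderiv_apply hU hh).comp_contDiff hg fun p => ⟨hSU (hfS p), Set.mem_univ _⟩
  rw [word_append_singleton, hcomp, word_const_smul l κ hsm, norm_smul,
    Real.norm_of_nonneg hκ.le, mul_comm]
  refine mul_le_mul_of_nonneg_right (hC _ hg hgS (fun m hm1 hmn q => ?_) l (by omega) p) hκ.le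
  rw [word_prodMk m hf hw', word_const_smul m _ hw, ← word_append_singleton]
  refine max_le ((hB m hm1 (by omega) q).trans ?_) ?_
  · have : 0 ≤ B * κ := (norm_nonneg _).trans (hB m hm1 (by omega) q)
    exact mul_le_of_le_one_right (nonneg_of_mul_nonneg_left this hκ) hκ1
  · change ‖κ⁻¹ • word (m ++ [b]) f q‖ ≤ B
    rw [norm_smul, norm_inv, Real.norm_of_nonneg hκ.le]
    exact hscale (hB (m ++ [b]) (by simp) (by simp; omega) q)

end Composition

end Heisenberg

/-! ### Avoiding zeros by a colored choice of coefficients -/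

namespace Heisenberg

section Avoidance

variable {F : Type*} [NormedAddCommGroup F] [InnerProductSpace ℝ F]

lemma le_norm_sum_smul_sub {e : Fin 4 → F} (he : Orthonormal ℝ e) {N : ℕ} {h : ℝ} (hh : 0 ≤ h)
    {s t : Fin 4 → Fin N} (hst : s ≠ t) :
    h ≤ ‖∑ l, (h * (s l : ℝ)) • e l - ∑ l, (h * (t l : ℝ)) • e l‖ := by
  obtain ⟨m, hm⟩ := Function.ne_iff.mp hst
  have hin : ⟪e m, ∑ l, (h * (s l : ℝ)) • e l - ∑ l, (h * (t l : ℝ)) • e l⟫ =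
      h * ((s m : ℝ) - (t m : ℝ)) := by
    rw [inner_sub_right, he.inner_right_fintype, he.inner_right_fintype]
    ring
  have h1 : (1 : ℝ) ≤ |(s m : ℝ) - (t m : ℝ)| := by
    have : (1 : ℤ) ≤ |((s m : ℕ) : ℤ) - ((t m : ℕ) : ℤ)| :=
      Int.one_le_abs (sub_ne_zero.mpr fun h => hm (Fin.ext (by exact_mod_cast h)))
    exact_mod_cast this
  calc h ≤ h * |(s m : ℝ) - (t m : ℝ)| := le_mul_of_one_le_right hh h1
    _ = |⟪e m, ∑ l, (h * (s l : ℝ)) • e l - ∑ l, (h * (t l : ℝ)) • e l⟫| := by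
      rw [hin, abs_mul, abs_of_nonneg hh]
    _ ≤ _ := by
      refine (abs_real_inner_le_norm _ _).trans ?_
      rw [he.1 m, one_mul]

lemma norm_sum_smul_le {e : Fin 4 → F} (he : Orthonormal ℝ e) {N : ℕ} {h : ℝ} (hh : 0 ≤ h)
    (t : Fin 4 → Fin N) : ‖∑ l, (h * (t l : ℝ)) • e l‖ ≤ 4 * (h * N) := by
  refine (norm_sum_le _ _).trans ((Finset.sum_le_card_nsmul _ _ (h * N) fun l _ => ?_).trans ?_)
  · rw [norm_smul, he.1 l, mul_one, Real.norm_of_nonneg (by positivity)]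
    gcongr
    exact_mod_cast (t l).2.le
  · simp

/-- A Lipschitz image of a three-dimensional box can be moved away from the origin by an
arbitrarily small translation in four-dimensional space. -/
theorem exists_small_translation {ε L : ℝ} (hε : 0 < ε) (hL : 0 ≤ L) :
    ∃ δ > 0, ∀ {T : Type} (g : T → F) (B : Set T) (e : Fin 4 → F), Orthonormal ℝ e →
      (∀ n : ℕ, 0 < n → ∃ cell : T → Fin n × Fin n × Fin n, ∀ p ∈ B, ∀ q ∈ B,
        cell p = cell q → ‖g p - g q‖ ≤ L / n) →
      ∃ a ∈ Submodule.span ℝ (Set.range e), ‖a‖ ≤ ε ∧ ∀ p ∈ B, δ ≤ ‖g p + a‖ := by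
  obtain ⟨t, ht⟩ := exists_nat_ge (16 * L / ε + 1)
  have ht0 : (0 : ℝ) < t := lt_of_lt_of_le (by positivity) ht
  have htn : 0 < t := by exact_mod_cast ht0
  set N : ℕ := t ^ 3 + 1 with hN
  have hN0 : (0 : ℝ) < N := by positivity
  have hLt : L / (t * N : ℕ) ≤ ε / (16 * N) := by
    have : 16 * L / ε ≤ t := by linarith
    rw [div_le_iff₀ hε] at this
    push_cast
    rw [div_le_div_iff₀ (by positivity) (by positivity)]
    nlinarith
  refine ⟨ε / (32 * N), by positivity, fun {T} g B e he hcell => ?_⟩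
  obtain ⟨cell, hcell⟩ := hcell (t * N) (by positivity)
  set h : ℝ := ε / (4 * N) with hh
  have hh0 : 0 < h := by positivity
  set v : (Fin 4 → Fin N) → F := fun s => ∑ l, (h * (s l : ℝ)) • e l with hv
  by_contra! hcon
  have hbad : ∀ s, ∃ p ∈ B, ‖g p + v s‖ < ε / (32 * N) := fun s =>
    hcon (v s) (Submodule.sum_mem _ fun l _ =>
      Submodule.smul_mem _ _ (Submodule.subset_span ⟨l, rfl⟩)) <|
      (norm_sum_smul_le he hh0.le s).trans_eq (by rw [hh]; field_simp)
  choose P hPB hP using hbad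
  have hcard : Fintype.card (Fin (t * N) × Fin (t * N) × Fin (t * N)) <
      Fintype.card (Fin 4 → Fin N) := by
    simp only [Fintype.card_prod, Fintype.card_fin, Fintype.card_fun]
    have : t * N * (t * N * (t * N)) = t ^ 3 * N ^ 3 := by ring
    rw [this, pow_succ N 3, mul_comm (N ^ 3)]
    exact Nat.mul_lt_mul_of_pos_right (by omega) (by positivity)
  obtain ⟨s, s', hss, heq⟩ := Fintype.exists_ne_map_eq_of_card_lt (fun s => cell (P s)) hcard
  have hsep : h ≤ ‖v s - v s'‖ := le_norm_sum_smul_sub he hh0.le hss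
  have hosc := hcell _ (hPB s) _ (hPB s') heq
  have htri : ‖v s - v s'‖ ≤ ‖g (P s) + v s‖ + ‖g (P s') + v s'‖ + ‖g (P s) - g (P s')‖ := by
    have : v s - v s' = (g (P s) + v s) - (g (P s') + v s') - (g (P s) - g (P s')) := by abel
    rw [this]
    exact (norm_sub_le _ _).trans (add_le_add_left (norm_sub_le _ _) _)
  have e1 : h = 8 * (ε / (32 * N)) := by rw [hh]; field_simp; norm_num
  have e2 : ε / (16 * N) = 2 * (ε / (32 * N)) := by field_simp; norm_num
  have e3 : 0 < ε / (32 * (N : ℝ)) := by positivity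
  linarith [hP s, hP s']

/-- A colored family of bump functions, together with three-dimensional boxes on which they are
equal to one; bumps of the same color are never simultaneously active. -/
structure ColoredBumps (ι T : Type) where
  bump : ι → T → ℝ
  box : ι → Set T
  active : ι → Set T
  col : ι → ℕ
  numCol : ℕ
  lip : ℝ
  lip_nonneg : 0 ≤ lip
  col_lt : ∀ i, col i < numCol
  bump_nonneg : ∀ i p, 0 ≤ bump i p
  bump_le_one : ∀ i p, bump i p ≤ 1
  bump_eq_one : ∀ i, ∀ p ∈ box i, bump i p = 1
  active_of_ne : ∀ i p, bump i p ≠ 0 → p ∈ active i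
  eq_of_col : ∀ i i' p, p ∈ active i → p ∈ active i' → col i = col i' → i = i'
  exists_cell : ∀ i, ∀ n : ℕ, 0 < n → ∃ cell : T → Fin n × Fin n × Fin n, ∀ p ∈ box i,
    ∀ q ∈ box i, cell p = cell q → ∀ i', |bump i' p - bump i' q| ≤ lip / n

namespace ColoredBumps

variable {ι T : Type} (S : ColoredBumps ι T)

/-- The superposition of the bumps with vector coefficients. -/
def sum (a : ι → F) (p : T) : F := ∑ᶠ i, S.bump i p • a i

lemma exists_active_finset (p : T) :
    ∃ A : Finset ι, A.card ≤ S.numCol ∧ ∀ i, p ∈ S.active i → i ∈ A := by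
  have hinj : Set.InjOn S.col {i | p ∈ S.active i} := fun i hi i' hi' h =>
    S.eq_of_col i i' p hi hi' h
  have hfin : {i | p ∈ S.active i}.Finite := by
    refine Set.Finite.of_finite_image ((Set.finite_lt_nat S.numCol).subset ?_) hinj
    rintro _ ⟨i, -, rfl⟩
    exact S.col_lt i
  refine ⟨hfin.toFinset, ?_, fun i hi => hfin.mem_toFinset.mpr hi⟩
  rw [← Finset.card_range S.numCol]
  exact Finset.card_le_card_of_injOn S.col (fun i _ => by simpa using S.col_lt i)
    (by simpa using hinj)

lemma sum_eq {A : Finset ι} {p : T} (hA : ∀ i, p ∈ S.active i → i ∈ A) (a : ι → F) :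
    S.sum a p = ∑ i ∈ A, S.bump i p • a i := by
  refine finsum_eq_sum_of_support_subset _ fun i hi => hA i (S.active_of_ne i p fun h => hi ?_)
  simp [h]

lemma norm_sum_le_card {a : ι → F} (ha : ∀ i, ‖a i‖ ≤ 1) (p : T) :
    ‖S.sum a p‖ ≤ S.numCol := by
  obtain ⟨A, hcard, hA⟩ := S.exists_active_finset p
  rw [S.sum_eq hA]
  refine (norm_sum_le _ _).trans ((Finset.sum_le_card_nsmul _ _ 1 fun i _ => ?_).trans ?_)
  · rw [norm_smul, Real.norm_of_nonneg (S.bump_nonneg i p)]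
    exact mul_le_one₀ (S.bump_le_one i p) (norm_nonneg _) (ha i)
  · simpa using hcard

lemma sum_add (a b : ι → F) (p : T) : S.sum (a + b) p = S.sum a p + S.sum b p := by
  obtain ⟨A, -, hA⟩ := S.exists_active_finset p
  simp only [S.sum_eq hA, Pi.add_apply, smul_add, Finset.sum_add_distrib]

/-- A superposition of bumps of a single color has at most one term at each point. -/
lemma sum_eq_of_active {c : ℕ} {b : ι → F} (hb : ∀ i, S.col i ≠ c → b i = 0) {i : ι} {p : T}
    (hi : p ∈ S.active i) (hc : S.col i = c) : S.sum b p = S.bump i p • b i := by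
  refine finsum_eq_single _ i fun i' hi' => ?_
  by_cases hc' : S.col i' = c
  · have : S.bump i' p = 0 := by
      by_contra h
      exact hi' (S.eq_of_col _ _ p (S.active_of_ne i' p h) hi (hc'.trans hc.symm))
    rw [this, zero_smul]
  · rw [hb i' hc', smul_zero]

lemma norm_sum_le_of_col {c : ℕ} {b : ι → F} (hb : ∀ i, S.col i ≠ c → b i = 0) {ε : ℝ}
    (hε : 0 ≤ ε) (hbε : ∀ i, ‖b i‖ ≤ ε) (p : T) : ‖S.sum b p‖ ≤ ε := by
  by_cases h : ∃ i, p ∈ S.active i ∧ S.col i = c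
  · obtain ⟨i, hi, hc⟩ := h
    rw [S.sum_eq_of_active hb hi hc, norm_smul, Real.norm_of_nonneg (S.bump_nonneg i p)]
    exact (mul_le_of_le_one_left (norm_nonneg _) (S.bump_le_one i p)).trans (hbε i)
  · have : S.sum b p = 0 := by
      refine finsum_eq_zero_of_forall_eq_zero fun i => ?_
      by_cases hc : S.col i = c
      · have : S.bump i p = 0 := by
          by_contra h'
          exact h ⟨i, S.active_of_ne i p h', hc⟩
        rw [this, zero_smul]
      · rw [hb i hc, smul_zero]
    rw [this, norm_zero]
    exact hε

lemma norm_sum_sub_sum_le {a : ι → F} (ha : ∀ i, ‖a i‖ ≤ 1) {p q : T} {η : ℝ} (hη : 0 ≤ η)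
    (h : ∀ i, |S.bump i p - S.bump i q| ≤ η) :
    ‖S.sum a p - S.sum a q‖ ≤ 2 * S.numCol * η := by
  classical
  obtain ⟨A, hcard, hA⟩ := S.exists_active_finset p
  obtain ⟨A', hcard', hA'⟩ := S.exists_active_finset q
  rw [S.sum_eq (A := A ∪ A') fun i hi => Finset.mem_union_left _ (hA i hi),
    S.sum_eq (A := A ∪ A') fun i hi => Finset.mem_union_right _ (hA' i hi),
    ← Finset.sum_sub_distrib]
  refine (norm_sum_le _ _).trans ((Finset.sum_le_card_nsmul _ _ η fun i _ => ?_).trans ?_)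
  · rw [← sub_smul, norm_smul, Real.norm_eq_abs]
    exact (mul_le_of_le_one_right (abs_nonneg _) (ha i)).trans (h i)
  · rw [nsmul_eq_mul]
    gcongr
    have : (A ∪ A').card ≤ 2 * S.numCol := (Finset.card_union_le _ _).trans (by omega)
    exact_mod_cast this

/-- The coefficients of a colored bump family can be chosen so that the superposition stays
uniformly away from the kernel of a prescribed contraction on each box, provided that each
contraction fixes a four-dimensional subspace. -/
theorem exists_coeff (S : ColoredBumps ι T) (s : ℕ) :
    ∃ c > 0, ∀ (P : ι → F →ₗ[ℝ] F) (e : ι → Fin 4 → F), (∀ i, Orthonormal ℝ (e i)) →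
      (∀ i l, P i (e i l) = e i l) → (∀ i x, ‖P i x‖ ≤ ‖x‖) →
      ∃ a : ι → F, (∀ i, ‖a i‖ ≤ 1) ∧ (∀ i, s ≤ S.col i → a i = 0) ∧
        ∀ i, S.col i < s → ∀ p ∈ S.box i, c ≤ ‖P i (S.sum a p)‖ := by
  induction s with
  | zero => exact ⟨1, one_pos, fun P e _ _ _ => ⟨0, by simp, by simp, by simp⟩⟩
  | succ s ih =>
    obtain ⟨c, hc, ih⟩ := ih
    have hε : 0 < min (c / 2) 1 := by positivity
    obtain ⟨δ, hδ, hpert⟩ := exists_small_translation (F := F) hε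
      (mul_nonneg (by positivity : (0 : ℝ) ≤ 2 * S.numCol) S.lip_nonneg)
    refine ⟨min (c / 2) δ, by positivity, fun P e he hPe hP => ?_⟩
    obtain ⟨a, ha1, ha0, hac⟩ := ih P e he hPe hP
    have hstep : ∀ i, ∃ x ∈ Submodule.span ℝ (Set.range (e i)), ‖x‖ ≤ min (c / 2) 1 ∧
        ∀ p ∈ S.box i, δ ≤ ‖P i (S.sum a p) + x‖ := fun i => by
      refine hpert (fun p => P i (S.sum a p)) (S.box i) (e i) (he i) fun n hn => ?_
      obtain ⟨cell, hcell⟩ := S.exists_cell i n hn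
      refine ⟨cell, fun p hp q hq hpq => ?_⟩
      rw [← map_sub, mul_div_assoc]
      exact (hP i _).trans (S.norm_sum_sub_sum_le ha1
        (div_nonneg S.lip_nonneg n.cast_nonneg) (hcell p hp q hq hpq))
    choose x hxe hx hxδ using hstep
    have hPx : ∀ i, P i (x i) = x i := fun i => by
      refine Submodule.span_induction (p := fun y _ => P i y = y) ?_ (map_zero _)
        (fun y z _ _ hy hz => by rw [map_add, hy, hz])
        (fun r y _ hy => by rw [map_smul, hy]) (hxe i)
      rintro _ ⟨l, rfl⟩
      exact hPe i l
    set b : ι → F := fun i => if S.col i = s then x i else 0 with hb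
    have hb0 : ∀ i, S.col i ≠ s → b i = 0 := fun i hi => if_neg hi
    have hbs : ∀ i, S.col i = s → b i = x i := fun i hi => if_pos hi
    have hbn : ∀ i, ‖b i‖ ≤ min (c / 2) 1 := fun i => by
      by_cases h : S.col i = s
      · rw [hbs i h]; exact hx i
      · rw [hb0 i h, norm_zero]; exact hε.le
    refine ⟨a + b, fun i => ?_, fun i hi => ?_, fun i hi p hp => ?_⟩
    · by_cases h : S.col i = s
      · rw [Pi.add_apply, ha0 i h.ge, zero_add]
        exact (hbn i).trans (min_le_right _ _)
      · rw [Pi.add_apply, hb0 i h, add_zero]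
        exact ha1 i
    · rw [Pi.add_apply, ha0 i (by omega), hb0 i (by omega), add_zero]
    · rw [S.sum_add, map_add]
      rcases Nat.lt_succ_iff_lt_or_eq.mp hi with h | h
      · have h1 := hac i h p hp
        have h2 := (hP i _).trans (S.norm_sum_le_of_col hb0 hε.le hbn p)
        have h3 := norm_sub_le (P i (S.sum a p) + P i (S.sum b p)) (P i (S.sum b p))
        rw [add_sub_cancel_right] at h3
        have h4 := min_le_left (c / 2) 1
        exact (min_le_left _ _).trans (by linarith)
      · have hp1 := S.bump_eq_one i p hp
        rw [S.sum_eq_of_active hb0 (S.active_of_ne i p (by simp [hp1])) h, hp1, one_smul,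
          hbs i h, hPx]
        exact (min_le_right _ _).trans (hxδ i p hp)

end ColoredBumps

end Avoidance

end Heisenberg

/-! ### Bump functions centered at the integer lattice -/

namespace Heisenberg

section Lattice

/-- The lattice point with the given integer coordinates. -/
def latticePoint (i : ℤ × ℤ × ℤ) : H := (i.1, i.2.1, i.2.2)

/-- A smooth bump on `H`, equal to one on the unit box. -/
def unitBump : ContDiffBump (0 : H) := ⟨1, 2, one_pos, one_lt_two⟩

lemma exists_lipschitz_unitBump :
    ∃ C : ℝ≥0, LipschitzWith C (unitBump : H → ℝ) :=
  (unitBump.contDiff (n := 1)).lipschitzWith_of_hasCompactSupport unitBump.hasCompactSupport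
    one_ne_zero

lemma unitBump_eq_zero {q : H} (hq : 2 ≤ ‖q‖) : unitBump q = 0 :=
  unitBump.zero_of_le_dist (by rw [dist_zero_right]; exact hq)

lemma exists_floor_cell {n : ℕ} (hn : 0 < n) : ∃ f : ℝ → Fin n, ∀ x ∈ Set.Ico (0 : ℝ) 1,
    ∀ y ∈ Set.Ico (0 : ℝ) 1, f x = f y → |x - y| ≤ 1 / n := by
  have hn' : (0 : ℝ) < n := by exact_mod_cast hn
  refine ⟨fun x => ⟨⌊n * x⌋₊ % n, Nat.mod_lt _ hn⟩, fun x hx y hy hxy => ?_⟩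
  have hlt : ∀ {z : ℝ}, z ∈ Set.Ico (0 : ℝ) 1 → ⌊n * z⌋₊ < n := fun {z} hz => by
    rw [Nat.floor_lt (mul_nonneg hn'.le hz.1)]
    nlinarith [hz.2]
  have heq : ⌊n * x⌋₊ = ⌊n * y⌋₊ := by
    simpa [Nat.mod_eq_of_lt (hlt hx), Nat.mod_eq_of_lt (hlt hy)] using hxy
  have hx1 := Nat.floor_le (mul_nonneg hn'.le hx.1)
  have hx2 := Nat.lt_floor_add_one (n * x)
  have hy1 := Nat.floor_le (mul_nonneg hn'.le hy.1)
  have hy2 := Nat.lt_floor_add_one (n * y)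
  rw [heq] at hx1 hx2
  have habs : |(x - y) * n| ≤ 1 := by
    rw [abs_le]
    constructor <;> nlinarith
  rwa [abs_mul, abs_of_pos hn', ← le_div_iff₀ hn'] at habs

/-- The unit box with corner at a lattice point. -/
def latticeBox (i : ℤ × ℤ × ℤ) : Set H :=
  {p | (rightTranslate (latticePoint i) p).1 ∈ Set.Ico (0 : ℝ) 1 ∧
    (rightTranslate (latticePoint i) p).2.1 ∈ Set.Ico (0 : ℝ) 1 ∧
    (rightTranslate (latticePoint i) p).2.2 ∈ Set.Ico (0 : ℝ) 1}

lemma exists_mem_latticeBox (p : H) : ∃ i, p ∈ latticeBox i := by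
  refine ⟨(⌊p.1⌋, ⌊p.2.1⌋, ⌊p.2.2 - (p.1 - ⌊p.1⌋) * ⌊p.2.1⌋⌋), ?_⟩
  simp only [latticeBox, Set.mem_ofPred_eq, rightTranslate_eq, latticePoint, Set.mem_Ico]
  refine ⟨⟨?_, ?_⟩, ⟨?_, ?_⟩, ?_, ?_⟩
  · linarith [Int.floor_le p.1]
  · linarith [Int.lt_floor_add_one p.1]
  · linarith [Int.floor_le p.2.1]
  · linarith [Int.lt_floor_add_one p.2.1]
  · linarith [Int.floor_le (p.2.2 - (p.1 - ⌊p.1⌋) * ⌊p.2.1⌋)]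
  · linarith [Int.lt_floor_add_one (p.2.2 - (p.1 - ⌊p.1⌋) * ⌊p.2.1⌋)]

lemma norm_le_iff_coords {q : H} {r : ℝ} : ‖q‖ ≤ r ↔ |q.1| ≤ r ∧ |q.2.1| ≤ r ∧ |q.2.2| ≤ r := by
  simp only [Prod.norm_def, max_le_iff, Real.norm_eq_abs]

lemma eq_of_abs_sub_le_of_emod {a b : ℤ} (x : ℝ) (ha : |x - a| ≤ 2) (hb : |x - b| ≤ 2)
    (h : a % 5 = b % 5) : a = b := by
  rw [abs_le] at ha hb
  have h1 : (a : ℝ) - b ≤ 4 := by linarith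
  have h2 : (b : ℝ) - a ≤ 4 := by linarith
  have h1' : a - b ≤ 4 := by exact_mod_cast h1
  have h2' : b - a ≤ 4 := by exact_mod_cast h2
  omega

/-- The region where the bump at a lattice point is active. -/
def activeRegion (i : ℤ × ℤ × ℤ) : Set H := {p | ‖rightTranslate (latticePoint i) p‖ ≤ 2}

/-- Residues modulo five of the three coordinates, packed into one number. -/
def latticeColor (i : ℤ × ℤ × ℤ) : ℕ := (i.1 % 5 + 5 * (i.2.1 % 5) + 25 * (i.2.2 % 5)).toNat

lemma eq_of_latticeColor (i i' : ℤ × ℤ × ℤ) (p : H) (hi : p ∈ activeRegion i)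
    (hi' : p ∈ activeRegion i') (h : latticeColor i = latticeColor i') : i = i' := by
  obtain ⟨a, b, c⟩ := i
  obtain ⟨a', b', c'⟩ := i'
  simp only [activeRegion, Set.mem_ofPred_eq, rightTranslate_eq, latticePoint,
    norm_le_iff_coords] at hi hi'
  simp only [latticeColor] at h
  obtain rfl : a = a' := eq_of_abs_sub_le_of_emod _ hi.1 hi'.1 (by omega)
  obtain rfl : b = b' := eq_of_abs_sub_le_of_emod _ hi.2.1 hi'.2.1 (by omega)
  obtain rfl : c = c' := by
    refine eq_of_abs_sub_le_of_emod (p.2.2 - (p.1 - a) * b) ?_ ?_ (by omega)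
    · rw [sub_right_comm]; exact hi.2.2
    · rw [sub_right_comm]; exact hi'.2.2
  rfl

lemma abs_unitBump_sub_le {C : ℝ≥0} (hC : LipschitzWith C (unitBump : H → ℝ))
    {i : ℤ × ℤ × ℤ} {p q : H} (hp : p ∈ latticeBox i) (hq : q ∈ latticeBox i) {η : ℝ}
    (h : ‖rightTranslate (latticePoint i) p - rightTranslate (latticePoint i) q‖ ≤ η)
    (i' : ℤ × ℤ × ℤ) :
    |unitBump (rightTranslate (latticePoint i') p) -
      unitBump (rightTranslate (latticePoint i') q)| ≤ C * (5 * η) := by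
  obtain ⟨a, b, c⟩ := i
  obtain ⟨a', b', c'⟩ := i'
  simp only [latticeBox, Set.mem_ofPred_eq, rightTranslate_eq, latticePoint, Set.mem_Ico,
    norm_le_iff_coords, Prod.fst_sub, Prod.snd_sub] at hp hq h ⊢
  have hη : 0 ≤ η := (abs_nonneg _).trans h.1
  by_cases hb : |(b : ℝ) - b'| ≤ 4
  · refine (hC.dist_le_mul _ _).trans ?_
    gcongr
    rw [dist_eq_norm, norm_le_iff_coords]
    simp only [Prod.fst_sub, Prod.snd_sub]
    obtain ⟨h1, h2, h3⟩ := h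
    refine ⟨?_, ?_, ?_⟩
    · rw [show p.1 - a' - (q.1 - a') = p.1 - a - (q.1 - a) by ring]; linarith
    · rw [show p.2.1 - b' - (q.2.1 - b') = p.2.1 - b - (q.2.1 - b) by ring]; linarith
    · rw [show p.2.2 - c' - (p.1 - a') * b' - (q.2.2 - c' - (q.1 - a') * b') =
        (p.2.2 - c - (p.1 - a) * b - (q.2.2 - c - (q.1 - a) * b)) +
          (p.1 - a - (q.1 - a)) * (b - b') by ring]
      refine (abs_add_le _ _).trans ?_
      rw [abs_mul]
      nlinarith [mul_le_mul h1 hb (abs_nonneg _) hη]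
  · have key : ∀ {r : H}, 0 ≤ r.2.1 - b → r.2.1 - b < 1 →
        2 ≤ ‖((r.1 - a', r.2.1 - b', r.2.2 - c' - (r.1 - a') * b') : H)‖ := fun {r} h0 h1 => by
      have hr : |r.2.1 - (b' : ℝ)| ≤ ‖((r.1 - a', r.2.1 - b', r.2.2 - c' - (r.1 - a') * b') : H)‖ :=
        (norm_le_iff_coords (q := (r.1 - a', r.2.1 - b', r.2.2 - c' - (r.1 - a') * b')).mp
          le_rfl).2.1
      refine le_trans ?_ hr
      rw [show r.2.1 - (b' : ℝ) = (r.2.1 - b) + (b - b') by ring]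
      rcases lt_abs.mp (not_le.mp hb) with h | h
      · exact le_abs.mpr (Or.inl (by linarith))
      · exact le_abs.mpr (Or.inr (by linarith))
    rw [unitBump_eq_zero (key hp.2.1.1 hp.2.1.2), unitBump_eq_zero (key hq.2.1.1 hq.2.1.2)]
    simp only [sub_zero, abs_zero]
    positivity

/-- The lattice translates of the unit bump, colored modulo five. -/
def latticeBumps : ColoredBumps (ℤ × ℤ × ℤ) H where
  bump i p := unitBump (rightTranslate (latticePoint i) p)
  box := latticeBox
  active := activeRegion
  col := latticeColor
  numCol := 125
  lip := 5 * exists_lipschitz_unitBump.choose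
  lip_nonneg := by positivity
  col_lt i := by unfold latticeColor; omega
  bump_nonneg i p := unitBump.nonneg
  bump_le_one i p := unitBump.le_one
  bump_eq_one i p hp := unitBump.one_of_mem_closedBall <| by
    change _ ∈ Metric.closedBall (0 : H) 1
    rw [mem_closedBall_zero_iff, norm_le_iff_coords]
    obtain ⟨h1, h2, h3⟩ := hp
    exact ⟨abs_le.mpr ⟨by linarith [h1.1], h1.2.le⟩, abs_le.mpr ⟨by linarith [h2.1], h2.2.le⟩,
      abs_le.mpr ⟨by linarith [h3.1], h3.2.le⟩⟩
  active_of_ne i p h := by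
    by_contra hc
    exact h (unitBump_eq_zero (not_le.mp hc).le)
  eq_of_col := eq_of_latticeColor
  exists_cell i n hn := by
    obtain ⟨f, hf⟩ := exists_floor_cell hn
    refine ⟨fun p => (f (rightTranslate (latticePoint i) p).1,
      f (rightTranslate (latticePoint i) p).2.1, f (rightTranslate (latticePoint i) p).2.2),
      fun p hp q hq hpq i' => ?_⟩
    simp only [Prod.mk.injEq] at hpq
    refine (abs_unitBump_sub_le exists_lipschitz_unitBump.choose_spec hp hq (η := 1 / n)
      (norm_le_iff_coords.mpr ⟨hf _ hp.1 _ hq.1 hpq.1, hf _ hp.2.1 _ hq.2.1 hpq.2.1,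
        hf _ hp.2.2 _ hq.2.2 hpq.2.2⟩) i').trans_eq ?_
    ring

lemma contDiff_latticeBumps (i : ℤ × ℤ × ℤ) :
    ContDiff ℝ (⊤ : ℕ∞) (latticeBumps.bump i) :=
  unitBump.contDiff.comp (contDiff_rightTranslate _)

lemma exists_finset_eventually_active (p₀ : H) : ∃ T : Finset (ℤ × ℤ × ℤ),
    ∀ᶠ p in nhds p₀, ∀ i, p ∈ activeRegion i → i ∈ T := by
  obtain ⟨N, hN⟩ := exists_nat_ge (3 * (‖p₀‖ + 1) + 6)
  refine ⟨Finset.Icc (-N : ℤ) N ×ˢ Finset.Icc (-N : ℤ) N ×ˢ Finset.Icc (-N : ℤ) N, ?_⟩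
  have hev : ∀ᶠ p in nhds p₀, ‖p‖ < ‖p₀‖ + 1 :=
    continuous_norm.continuousAt.eventually_lt continuousAt_const (by linarith)
  filter_upwards [hev] with p hp i hi
  obtain ⟨a, b, c⟩ := i
  obtain ⟨h1, h2, h3⟩ := norm_le_iff_coords.mp hp.le
  simp only [activeRegion, Set.mem_ofPred_eq, rightTranslate_eq, latticePoint,
    norm_le_iff_coords] at hi
  obtain ⟨k1, k2, k3⟩ := hi
  have hR := norm_nonneg p₀
  have tri : ∀ {x y r : ℝ}, |x| ≤ r → |x - y| ≤ 2 → |y| ≤ r + 2 := fun {x y r} hx hxy => by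
    rw [abs_le] at *
    constructor <;> linarith
  have hb := tri h2 k2
  have hprod : |(p.1 - a) * b| ≤ 2 * (‖p₀‖ + 1 + 2) := by
    rw [abs_mul]
    exact mul_le_mul k1 hb (abs_nonneg _) zero_le_two
  have hc : |(c : ℝ)| ≤ N := by
    rw [abs_le] at *
    constructor <;> linarith
  have ha : |(a : ℝ)| ≤ N := (tri h1 k1).trans (by linarith)
  have hb' : |(b : ℝ)| ≤ N := hb.trans (by linarith)
  have cast : ∀ {z : ℤ}, |(z : ℝ)| ≤ N → z ∈ Finset.Icc (-N : ℤ) N := fun {z} hz => by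
    rw [Finset.mem_Icc, ← abs_le]
    exact_mod_cast hz
  simp only [Finset.mem_product]
  exact ⟨cast ha, cast hb', cast hc⟩

variable {E : Type*} [NormedAddCommGroup E] [InnerProductSpace ℝ E]

lemma exists_sum_eventuallyEq (a : ℤ × ℤ × ℤ → E) (p₀ : H) : ∃ T : Finset (ℤ × ℤ × ℤ),
    latticeBumps.sum a =ᶠ[nhds p₀] fun p => ∑ i ∈ T, latticeBumps.bump i p • a i := by
  obtain ⟨T, hT⟩ := exists_finset_eventually_active p₀
  exact ⟨T, hT.mono fun p hp => latticeBumps.sum_eq hp a⟩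

lemma contDiff_latticeBumps_sum (a : ℤ × ℤ × ℤ → E) :
    ContDiff ℝ (⊤ : ℕ∞) (latticeBumps.sum a) := by
  refine contDiff_iff_contDiffAt.mpr fun p => ?_
  obtain ⟨T, hT⟩ := exists_sum_eventuallyEq a p
  refine ContDiffAt.congr_of_eventuallyEq (ContDiff.contDiffAt ?_) hT
  exact ContDiff.sum fun i _ => (contDiff_latticeBumps i).smul contDiff_const

lemma word_unitBump_eq_zero (l : List Bool) {q : H} (hq : 2 < ‖q‖) :
    word l unitBump q = 0 := by
  have h : (unitBump : H → ℝ) =ᶠ[nhds q] fun _ => (0 : ℝ) • (0 : ℝ) := by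
    filter_upwards [continuous_norm.continuousAt.eventually_const_lt hq] with x hx
    rw [unitBump_eq_zero hx.le, zero_smul]
  rw [(word_eventuallyEq l h).eq_of_nhds, word_const_smul l 0 contDiff_const]
  exact zero_smul _ _

lemma exists_word_unitBump_le (n : ℕ) :
    ∃ C : ℝ, 0 ≤ C ∧ ∀ l : List Bool, l.length ≤ n → ∀ q, |word l unitBump q| ≤ C := by
  have h : ∀ l : List Bool, ∃ C : ℝ, 0 ≤ C ∧ ∀ q, |word l unitBump q| ≤ C := fun l => by
    obtain ⟨C, hC⟩ := (isCompact_closedBall (0 : H) 2).exists_bound_of_continuousOn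
      (contDiff_word l unitBump.contDiff).continuous.continuousOn
    refine ⟨max C 0, le_max_right _ _, fun q => ?_⟩
    by_cases hq : ‖q‖ ≤ 2
    · exact (hC q (mem_closedBall_zero_iff.mpr hq)).trans (le_max_left _ _)
    · rw [word_unitBump_eq_zero l (not_le.mp hq), abs_zero]
      exact le_max_right _ _
  choose C hC0 hC using h
  obtain ⟨M, hM⟩ := ((List.finite_length_le Bool n).image C).bddAbove
  exact ⟨max M 0, le_max_right _ _, fun l hl q =>
    ((hC l q).trans (hM ⟨l, hl, rfl⟩)).trans (le_max_left _ _)⟩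

/-- Horizontal derivatives of superpositions of lattice bumps are uniformly bounded. -/
theorem exists_word_latticeBumps_sum_le (n : ℕ) :
    ∃ C : ℝ, 0 ≤ C ∧ ∀ a : ℤ × ℤ × ℤ → E, (∀ i, ‖a i‖ ≤ 1) → ∀ l : List Bool, l.length ≤ n →
      ∀ p, ‖word l (latticeBumps.sum a) p‖ ≤ C := by
  classical
  obtain ⟨C, hC0, hC⟩ := exists_word_unitBump_le n
  refine ⟨125 * C, by positivity, fun a ha l hl p => ?_⟩
  obtain ⟨T, hT⟩ := exists_sum_eventuallyEq a p
  obtain ⟨A, hcard, hA⟩ := latticeBumps.exists_active_finset p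
  have hw : ∀ i, word l (latticeBumps.bump i) p =
      word l unitBump (rightTranslate (latticePoint i) p) := fun i =>
    congrFun (word_comp_rightTranslate l (latticePoint i) unitBump.contDiff) p
  rw [(word_eventuallyEq l hT).eq_of_nhds, word_sum_smul T l a contDiff_latticeBumps]
  dsimp only
  rw [← Finset.sum_subset (Finset.inter_subset_left (s₁ := T) (s₂ := A)) fun i hiT hi => ?_]
  · refine (norm_sum_le _ _).trans ((Finset.sum_le_card_nsmul _ _ C fun i _ => ?_).trans ?_)
    · rw [norm_smul, hw]
      exact (mul_le_of_le_one_right (norm_nonneg _) (ha i)).trans (hC l hl _)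
    · rw [nsmul_eq_mul]
      gcongr
      exact_mod_cast (Finset.card_le_card Finset.inter_subset_right).trans hcard
  · rw [hw, word_unitBump_eq_zero, zero_smul]
    by_contra hc
    exact hi (Finset.mem_inter.mpr ⟨hiT, hA i (not_lt.mp hc)⟩)

end Lattice

/-! ### Oscillation along horizontal flows -/

section Flow

variable {E : Type*} [NormedAddCommGroup E] [NormedSpace ℝ E]

lemma norm_flow_sub_le {f : H → E} (hf : ContDiff ℝ (⊤ : ℕ∞) f) {K : ℝ}
    (hK : ∀ b p, ‖WD b f p‖ ≤ K) (b : Bool) (t : ℝ) (p : H) :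
    ‖f (flow b t p) - f p‖ ≤ K * |t| := by
  have hflow : ∀ s, HasDerivAt (fun s => flow b s p) (horizontalVec b (flow b s p)) s :=
    fun s => by
    cases b
    · exact (hasDerivAt_const s _).prodMk
        (((hasDerivAt_id s).const_add _).prodMk (hasDerivAt_const s _))
    · have h := ((hasDerivAt_id s).const_add p.1).prodMk ((hasDerivAt_const s p.2.1).prodMk
        (((hasDerivAt_id s).mul_const p.2.1).const_add p.2.2))
      rw [one_mul] at h
      exact h
  have hder : ∀ s, HasDerivAt (fun s => f (flow b s p)) (WD b f (flow b s p)) s := fun s => by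
    rw [WD_apply]
    exact (hf.differentiableAt_top _).hasFDerivAt.comp_hasDerivAt s (hflow s)
  have h := Convex.norm_image_sub_le_of_norm_hasDerivWithin_le (s := Set.univ) (x := 0) (y := t)
    (fun s _ => (hder s).hasDerivWithinAt) (fun s _ => hK b _) convex_univ (Set.mem_univ _)
    (Set.mem_univ _)
  have h0 : flow b 0 p = p := by cases b <;> simp [flow, flowX, flowY]
  simpa [h0] using h

lemma norm_sub_latticePoint_le {f : H → E} (hf : ContDiff ℝ (⊤ : ℕ∞) f) {K : ℝ}
    (hK : ∀ b p, ‖WD b f p‖ ≤ K) {i : ℤ × ℤ × ℤ} {p : H} (hp : p ∈ latticeBox i) :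
    ‖f p - f (latticePoint i)‖ ≤ 6 * K := by
  have hK0 : 0 ≤ K := (norm_nonneg _).trans (hK true p)
  have hstep : ∀ (b : Bool) (t : ℝ), |t| ≤ 1 → ∀ q, ‖f (flow b t q) - f q‖ ≤ K :=
    fun b t ht q => (norm_flow_sub_le hf hK b t q).trans (mul_le_of_le_one_right hK0 ht)
  have hunit : ∀ {t : ℝ}, t ∈ Set.Ico (0 : ℝ) 1 → |t| ≤ 1 := fun {t} ht =>
    abs_le.mpr ⟨by linarith [ht.1], ht.2.le⟩
  set γ := latticePoint i
  obtain ⟨hx, hy, hz⟩ := hp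
  set q := rightTranslate γ p with hq
  have hpq : p = flow false q.2.1 (flow true q.1 (flow true q.2.2 (flow false 1
      (flow true (-q.2.2) (flow false (-1) γ))))) := by
    rw [hq, rightTranslate_eq]
    simp only [flow, flowX, flowY]
    ext <;> simp only <;> ring
  set q₁ := flow false (-1) γ with e1
  set q₂ := flow true (-q.2.2) q₁ with e2
  set q₃ := flow false 1 q₂ with e3
  set q₄ := flow true q.2.2 q₃ with e4
  set q₅ := flow true q.1 q₄ with e5
  have h1 : ‖f q₁ - f γ‖ ≤ K := hstep false (-1) (by simp) γ
  have h2 : ‖f q₂ - f q₁‖ ≤ K := hstep true (-q.2.2) (by rw [abs_neg]; exact hunit hz) q₁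
  have h3 : ‖f q₃ - f q₂‖ ≤ K := hstep false 1 (by simp) q₂
  have h4 : ‖f q₄ - f q₃‖ ≤ K := hstep true q.2.2 (hunit hz) q₃
  have h5 : ‖f q₅ - f q₄‖ ≤ K := hstep true q.1 (hunit hx) q₄
  have h6 : ‖f p - f q₅‖ ≤ K := by rw [hpq]; exact hstep false q.2.1 (hunit hy) q₅
  have t1 := norm_sub_le_norm_sub_add_norm_sub (f p) (f q₅) (f γ)
  have t2 := norm_sub_le_norm_sub_add_norm_sub (f q₅) (f q₄) (f γ)
  have t3 := norm_sub_le_norm_sub_add_norm_sub (f q₄) (f q₃) (f γ)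
  have t4 := norm_sub_le_norm_sub_add_norm_sub (f q₃) (f q₂) (f γ)
  have t5 := norm_sub_le_norm_sub_add_norm_sub (f q₂) (f q₁) (f γ)
  linarith

end Flow

end Heisenberg

/-! ### Projection away from an orthonormal family -/

namespace Heisenberg

section Projection

variable {V : Type*} [NormedAddCommGroup V] [InnerProductSpace ℝ V] {k : ℕ}

/-- The component of `a` orthogonal to the orthonormal family `u`. -/
def reject (u : Fin k → V) : V →ₗ[ℝ] V :=
  LinearMap.id - ∑ i, (innerₛₗ ℝ (u i)).smulRight (u i)

lemma reject_apply (u : Fin k → V) (a : V) : reject u a = a - ∑ i, ⟪u i, a⟫ • u i := by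
  simp [reject]

lemma inner_reject {u : Fin k → V} (hu : Orthonormal ℝ u) (a : V) (i : Fin k) :
    ⟪u i, reject u a⟫ = 0 := by
  rw [reject_apply, inner_sub_right, hu.inner_right_fintype, sub_self]

lemma norm_reject_le {u : Fin k → V} (hu : Orthonormal ℝ u) (a : V) :
    ‖reject u a‖ ≤ ‖a‖ := by
  have h : ⟪reject u a, reject u a⟫ = ⟪a, reject u a⟫ := by
    conv_lhs => enter [2]; rw [reject_apply]
    rw [inner_sub_left, sum_inner, Finset.sum_eq_zero, sub_zero]
    intro i _
    rw [real_inner_smul_left, inner_reject hu, mul_zero]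
  have h' : ‖reject u a‖ * ‖reject u a‖ ≤ ‖a‖ * ‖reject u a‖ := by
    rw [← real_inner_self_eq_norm_mul_norm, h]
    exact real_inner_le_norm _ _
  rcases (norm_nonneg (reject u a)).eq_or_lt with h0 | h0
  · rw [← h0]; exact norm_nonneg a
  · exact le_of_mul_le_mul_right h' h0

lemma norm_reject_sub_le {u u' : Fin k → V} (hu : ∀ i, ‖u i‖ = 1) (hu' : ∀ i, ‖u' i‖ = 1)
    {η : ℝ} (h : ∀ i, ‖u i - u' i‖ ≤ η) (a : V) :
    ‖reject u a - reject u' a‖ ≤ k * (2 * η * ‖a‖) := by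
  have hsub : reject u a - reject u' a =
      ∑ i, (⟪u' i - u i, a⟫ • u i + ⟪u' i, a⟫ • (u' i - u i)) := by
    rw [reject_apply, reject_apply, sub_sub_sub_cancel_left, ← Finset.sum_sub_distrib]
    refine Finset.sum_congr rfl fun i _ => ?_
    rw [inner_sub_left, sub_smul, smul_sub]
    abel
  rw [hsub]
  refine (norm_sum_le _ _).trans ((Finset.sum_le_card_nsmul _ _ (2 * η * ‖a‖) fun i _ => ?_).trans
    (by simp))
  refine (norm_add_le _ _).trans ?_
  have hi : ‖u' i - u i‖ ≤ η := by rw [norm_sub_rev]; exact h i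
  rw [norm_smul, norm_smul, hu i, mul_one, Real.norm_eq_abs, Real.norm_eq_abs]
  have h1 := (abs_real_inner_le_norm (u' i - u i) a).trans
    (mul_le_mul_of_nonneg_right hi (norm_nonneg a))
  have h2 := abs_real_inner_le_norm (u' i) a
  rw [hu' i, one_mul] at h2
  have h3 := mul_le_mul h2 hi (norm_nonneg _) (norm_nonneg a)
  linarith

lemma exists_orthonormal_reject_eq [FiniteDimensional ℝ V] {u : Fin k → V}
    (hu : Orthonormal ℝ u) {m : ℕ} (hm : k + m ≤ Module.finrank ℝ V) :
    ∃ e : Fin m → V, Orthonormal ℝ e ∧ ∀ l, reject u (e l) = e l := by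
  set W := Submodule.span ℝ (Set.range u)
  have hW : Module.finrank ℝ W = k := by
    simpa using finrank_span_eq_card hu.linearIndependent
  have hWo : m ≤ Module.finrank ℝ Wᗮ := by
    have := W.finrank_add_finrank_orthogonal
    omega
  set b := stdOrthonormalBasis ℝ Wᗮ
  refine ⟨fun l => b (Fin.castLE hWo l), ?_, fun l => ?_⟩
  · exact (b.orthonormal.comp _ (Fin.castLE_injective hWo)).comp_linearIsometry Wᗮ.subtypeₗᵢ
  · rw [reject_apply, Finset.sum_eq_zero, sub_zero]
    intro i _
    rw [(Submodule.mem_orthogonal W _).mp (b (Fin.castLE hWo l)).2 (u i)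
      (Submodule.subset_span ⟨i, rfl⟩), zero_smul]

/-- The normalized component of `x.1` orthogonal to the family `x.2`. -/
def unitReject (x : V × (Fin k → V)) : V := ‖reject x.2 x.1‖⁻¹ • reject x.2 x.1

lemma contDiff_reject :
    ContDiff ℝ (⊤ : ℕ∞) fun x : V × (Fin k → V) => reject x.2 x.1 := by
  simp only [reject_apply]
  have h : ∀ i, ContDiff ℝ (⊤ : ℕ∞) fun x : V × (Fin k → V) => x.2 i := fun i =>
    (contDiff_apply ℝ V i).comp contDiff_snd
  exact contDiff_fst.sub (ContDiff.sum fun i _ => ((h i).inner ℝ contDiff_fst).smul (h i))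

lemma contDiffOn_unitReject : ContDiffOn ℝ (⊤ : ℕ∞) (unitReject (V := V) (k := k))
    {x | reject x.2 x.1 ≠ 0} := by
  have h : ContDiffOn ℝ (⊤ : ℕ∞) (fun x : V × (Fin k → V) => reject x.2 x.1)
      {x | reject x.2 x.1 ≠ 0} := contDiff_reject.contDiffOn
  exact ((h.norm ℝ fun x hx => hx).inv fun x (hx : reject x.2 x.1 ≠ 0) =>
    norm_ne_zero_iff.mpr hx).smul h

lemma isOpen_reject_ne_zero : IsOpen {x : V × (Fin k → V) | reject x.2 x.1 ≠ 0} :=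
  isOpen_ne_fun contDiff_reject.continuous continuous_const

lemma isCompact_reject_region [FiniteDimensional ℝ V] (M c : ℝ) :
    IsCompact {x : V × (Fin k → V) | ‖x‖ ≤ M ∧ c ≤ ‖reject x.2 x.1‖} := by
  have : {x : V × (Fin k → V) | ‖x‖ ≤ M ∧ c ≤ ‖reject x.2 x.1‖} =
      Metric.closedBall 0 M ∩ {x | c ≤ ‖reject x.2 x.1‖} := by
    ext x
    simp
  rw [this]
  exact (isCompact_closedBall 0 M).inter_right
    (isClosed_le continuous_const contDiff_reject.continuous.norm)

end Projection

/-! ### Norms of iterated gradients and words -/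

section GradNorm

variable {E : Type*} [NormedAddCommGroup E] [NormedSpace ℝ E]

lemma norm_word_le_gradNorm (l : List Bool) (φ : H → E) (p : H) :
    ‖word l φ p‖ ≤ gradNorm l.length φ p := by
  refine Real.le_sqrt_of_sq_le ?_
  have h : ‖word l φ p‖ ^ 2 = ‖(List.ofFn l.get).foldr WD φ p‖ ^ 2 := by
    rw [List.ofFn_get]; rfl
  rw [h]
  exact Finset.single_le_sum (f := fun w : Fin l.length → Bool =>
    ‖(List.ofFn w).foldr WD φ p‖ ^ 2) (fun w _ => sq_nonneg _) (Finset.mem_univ l.get)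

lemma gradNorm_le {n : ℕ} {φ : H → E} {p : H} {B : ℝ} (hB : 0 ≤ B)
    (h : ∀ l : List Bool, l.length = n → ‖word l φ p‖ ≤ B) : gradNorm n φ p ≤ 2 ^ n * B := by
  refine (Real.sqrt_le_left (by positivity)).mpr ?_
  refine (Finset.sum_le_card_nsmul _ _ (B ^ 2) fun w _ => ?_).trans ?_
  · exact pow_le_pow_left₀ (norm_nonneg _) (h (List.ofFn w) (by simp)) 2
  · have h1 : (1 : ℝ) ≤ 2 ^ n := one_le_pow₀ one_le_two
    simp only [Finset.card_univ, Fintype.card_fun, Fintype.card_bool, Fintype.card_fin,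
      nsmul_eq_mul, Nat.cast_pow, Nat.cast_ofNat, mul_pow]
    gcongr
    nlinarith

lemma norm_word_le_of_CkRS_le {j : ℕ} {φ : H → E} {K : ℝ} (hK : 0 ≤ K)
    (h : CkRS 1 j 1 φ ≤ ENNReal.ofReal K) {l : List Bool} (hl1 : 1 ≤ l.length)
    (hlj : l.length ≤ j + 1) (p : H) : ‖word l φ p‖ ≤ K := by
  refine (norm_word_le_gradNorm l φ p).trans ((ENNReal.ofReal_le_ofReal_iff hK).mp ?_)
  refine le_trans ?_ h
  have hm : l.length - 1 ∈ Finset.range (j + 1) := Finset.mem_range.mpr (by omega)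
  have h1 : 1 + (l.length - 1) = l.length := by omega
  refine le_trans ?_ (Finset.single_le_sum (fun _ _ => zero_le) hm)
  rw [one_pow, ENNReal.ofReal_one, one_mul, h1]
  exact le_iSup (fun p => ENNReal.ofReal (gradNorm l.length φ p)) p

lemma CkRS_le_of_norm_word_le {j : ℕ} {φ : H → E} {B : ℝ} (hB : 0 ≤ B)
    (h : ∀ l : List Bool, 1 ≤ l.length → l.length ≤ j + 1 → ∀ p, ‖word l φ p‖ ≤ B) :
    CkRS 1 j 1 φ ≤ ENNReal.ofReal ((j + 1) * 2 ^ (j + 1) * B) := by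
  have hterm : ∀ m ∈ Finset.range (j + 1), ENNReal.ofReal ((1 : ℝ) ^ m) *
      ⨆ p : H, ENNReal.ofReal (gradNorm (1 + m) φ p) ≤ ENNReal.ofReal (2 ^ (j + 1) * B) := by
    intro m hm
    have hm' := Finset.mem_range.mp hm
    rw [one_pow, ENNReal.ofReal_one, one_mul]
    refine iSup_le fun p => ENNReal.ofReal_le_ofReal ?_
    refine (gradNorm_le hB fun l hl => h l (by omega) (by omega) p).trans ?_
    exact mul_le_mul_of_nonneg_right (pow_le_pow_right₀ one_le_two (by omega)) hB
  refine (Finset.sum_le_card_nsmul _ _ _ hterm).trans_eq ?_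
  rw [Finset.card_range, nsmul_eq_mul, mul_assoc, ENNReal.ofReal_mul (p := (j : ℝ) + 1) (by positivity),
    ← Nat.cast_add_one, ENNReal.ofReal_natCast]

end GradNorm

/-! ### The lifting theorem in terms of words -/

section Lifting

variable {V : Type} [NormedAddCommGroup V] [InnerProductSpace ℝ V] [FiniteDimensional ℝ V] {k : ℕ}

/-- There is a slowly varying field, at the scale `r`, whose component orthogonal to a given
slowly varying orthonormal family is bounded below. -/
theorem exists_field_reject_ge (hk : k + 4 ≤ Module.finrank ℝ V) (n : ℕ) :
    ∃ c > 0, ∃ B : ℝ, ∀ K : ℝ, 0 < K → K ≤ 1 → ∀ v : Fin k → H → V,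
      (∀ i, ContDiff ℝ (⊤ : ℕ∞) (v i)) → (∀ p, Orthonormal ℝ fun i => v i p) →
      (∀ i b p, ‖WD b (v i) p‖ ≤ K) →
      ∃ g : H → V, ContDiff ℝ (⊤ : ℕ∞) g ∧ (∀ p, ‖g p‖ ≤ 125) ∧
        (∀ p, c ≤ ‖reject (fun i => v i p) (g p)‖) ∧
        ∀ l : List Bool, 1 ≤ l.length → l.length ≤ n → ∀ p, ‖word l g p‖ ≤ B * K := by
  obtain ⟨c, hc, hcoeff⟩ := latticeBumps.exists_coeff (F := V) 125
  obtain ⟨C, hC0, hC⟩ := exists_word_latticeBumps_sum_le (E := V) n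
  set ρ : ℝ := c / (3000 * (k + 1)) with hρ
  have hρ0 : 0 < ρ := by positivity
  refine ⟨c / 2, by positivity, (1 + ρ⁻¹) ^ n * C, fun K hK hK1 v hv hon hvK => ?_⟩
  set r : ℝ := ρ / K with hr
  have hr0 : 0 < r := by positivity
  choose e he hPe using fun i : ℤ × ℤ × ℤ =>
    exists_orthonormal_reject_eq (hon (dilate r (latticePoint i))) hk
  obtain ⟨a, ha1, -, hac⟩ := hcoeff (fun i => reject fun m => v m (dilate r (latticePoint i)))
    e he hPe fun i => norm_reject_le (hon _)
  have hg := contDiff_latticeBumps_sum a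
  have hbound : ∀ p, ‖latticeBumps.sum a p‖ ≤ 125 := fun p => by
    have := latticeBumps.norm_sum_le_card ha1 p
    exact_mod_cast this
  refine ⟨latticeBumps.sum a ∘ dilate r⁻¹, hg.comp (contDiff_dilate _), fun p => hbound _,
    fun p => ?_, fun l hl1 hln p => ?_⟩
  · set p' := dilate r⁻¹ p with hp'
    have hpp' : dilate r p' = p := by
      simp only [hp', dilate]
      ext <;> field_simp
    obtain ⟨i, hi⟩ := exists_mem_latticeBox p'
    have hosc : ∀ m, ‖v m (dilate r (latticePoint i)) - v m p‖ ≤ 6 * ρ := fun m => by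
      have h := norm_sub_latticePoint_le (f := v m ∘ dilate r) (K := ρ)
        ((hv m).comp (contDiff_dilate r)) (fun b q => ?_) hi
      · rw [norm_sub_rev, ← hpp']
        exact h
      · have h1 := congrFun (word_comp_dilate [b] r (hv m)) q
        simp only [word_cons, word_nil, List.length_singleton, pow_one] at h1
        rw [h1, norm_smul, Real.norm_of_nonneg hr0.le]
        calc r * ‖WD b (v m) (dilate r q)‖ ≤ r * K := by gcongr; exact hvK m b _
          _ = ρ := div_mul_cancel₀ _ hK.ne'
    have h1 := hac i (latticeBumps.col_lt i) p' hi
    have h2 := norm_reject_sub_le (fun m => (hon (dilate r (latticePoint i))).1 m)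
      (fun m => (hon p).1 m) hosc (latticeBumps.sum a p')
    have h3 : (k : ℝ) * (2 * (6 * ρ) * ‖latticeBumps.sum a p'‖) ≤ c / 2 := by
      calc (k : ℝ) * (2 * (6 * ρ) * ‖latticeBumps.sum a p'‖)
          ≤ (k + 1) * (2 * (6 * ρ) * 125) := by
            gcongr
            · linarith
            · exact hbound p'
        _ = c / 2 := by rw [hρ]; field_simp; norm_num
    have h4 := norm_sub_norm_le (reject (fun m => v m (dilate r (latticePoint i)))
      (latticeBumps.sum a p')) (reject (fun m => v m p) (latticeBumps.sum a p'))
    change c / 2 ≤ ‖reject (fun m => v m p) (latticeBumps.sum a p')‖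
    linarith
  · rw [word_comp_dilate l _ hg, norm_smul, norm_pow, norm_inv, Real.norm_of_nonneg hr0.le]
    have hrinv : r⁻¹ = ρ⁻¹ * K := by rw [hr]; field_simp
    have hρ1 : 0 ≤ ρ⁻¹ := by positivity
    calc r⁻¹ ^ l.length * ‖word l (latticeBumps.sum a) (dilate r⁻¹ p)‖
        ≤ ((1 + ρ⁻¹) ^ n * K) * C := by
          gcongr
          · rw [hrinv, mul_pow]
            gcongr
            · calc ρ⁻¹ ^ l.length ≤ (1 + ρ⁻¹) ^ l.length := by gcongr; linarith
                _ ≤ (1 + ρ⁻¹) ^ n := by gcongr; linarith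
            · exact pow_le_of_le_one hK.le hK1 (by omega)
          · exact hC a ha1 l hln _
      _ = (1 + ρ⁻¹) ^ n * C * K := by ring

theorem exists_unit_normal (hk : k + 4 ≤ Module.finrank ℝ V) (n : ℕ) :
    ∃ C : ℝ, ∀ K : ℝ, 0 < K → K ≤ 1 → ∀ v : Fin k → H → V,
      (∀ i, ContDiff ℝ (⊤ : ℕ∞) (v i)) → (∀ p, Orthonormal ℝ fun i => v i p) →
      (∀ i, ∀ l : List Bool, 1 ≤ l.length → l.length ≤ n + 1 → ∀ p, ‖word l (v i) p‖ ≤ K) →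
      ∃ w : H → V, ContDiff ℝ (⊤ : ℕ∞) w ∧ (∀ p, ‖w p‖ = 1) ∧ (∀ p i, ⟪w p, v i p⟫ = 0) ∧
        ∀ l : List Bool, 1 ≤ l.length → l.length ≤ n + 1 → ∀ p, ‖word l w p‖ ≤ C * K := by
  obtain ⟨c, hc, B, hfield⟩ := exists_field_reject_ge hk (n + 1)
  have hsub : {x : V × (Fin k → V) | ‖x‖ ≤ 125 ∧ c ≤ ‖reject x.2 x.1‖} ⊆
      {x | reject x.2 x.1 ≠ 0} := fun x hx h0 => by
    have := hx.2
    rw [h0, norm_zero] at this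
    linarith
  obtain ⟨C, hC⟩ := exists_word_comp_le_mul (n + 1) (unitReject (V := V) (k := k)) _ _
    isOpen_reject_ne_zero (isCompact_reject_region 125 c) hsub contDiffOn_unitReject (max B 1)
  refine ⟨C, fun K hK hK1 v hv hon hvK => ?_⟩
  obtain ⟨g, hg, hg125, hgc, hgB⟩ := hfield K hK hK1 v hv hon fun i b p =>
    hvK i [b] le_rfl (by simp) p
  have hvpi : ContDiff ℝ (⊤ : ℕ∞) fun p i => v i p := contDiff_pi.mpr hv
  have hf : ContDiff ℝ (⊤ : ℕ∞) fun p => (g p, fun i => v i p) := hg.prodMk hvpi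
  have hfS : ∀ p, ((g p, fun i => v i p) : V × (Fin k → V)) ∈
      {x : V × (Fin k → V) | ‖x‖ ≤ 125 ∧ c ≤ ‖reject x.2 x.1‖} := fun p =>
    ⟨max_le (hg125 p) ((pi_norm_le_iff_of_nonneg (by norm_num)).mpr fun i => by
      rw [(hon p).1 i]; norm_num), hgc p⟩
  refine ⟨unitReject ∘ fun p => (g p, fun i => v i p),
    contDiffOn_unitReject.comp_contDiff hf fun p => hsub (hfS p), fun p => ?_, fun p i => ?_, ?_⟩
  · exact norm_smul_inv_norm (𝕜 := ℝ) (hsub (hfS p))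
  · rw [real_inner_comm]
    change ⟪v i p, ‖reject (fun i => v i p) (g p)‖⁻¹ • reject (fun i => v i p) (g p)⟫ = 0
    rw [real_inner_smul_right, inner_reject (hon p), mul_zero]
  · refine hC K hK hK1 _ hf hfS fun l hl1 hln p => ?_
    rw [word_prodMk l hg hvpi, word_pi l hv]
    refine max_le ((hgB l hl1 hln p).trans ?_) ?_
    · gcongr
      exact le_max_left _ _
    · refine (pi_norm_le_iff_of_nonneg (by positivity)).mpr fun i => (hvK i l hl1 hln p).trans ?_
      exact le_mul_of_one_le_left hK.le (le_max_right _ _)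

end Lifting

end Heisenberg

/-- **`C^j` lifting** (Corollary 7.4 of the paper).  Given smooth pointwise-orthonormal
maps `v₁,…,v_k : H → S^{D-1}` with `‖∇v_i‖_{C^j} ≤ K < 1`, there is a smooth unit map
`v_{k+1}` pointwise orthogonal to all of them with `‖∇v_{k+1}‖_{C^j} ≤ C(D,j)·K`. -/
theorem statement8 (D k j : ℕ) (hk : 1 ≤ k) (hkD : k + 4 ≤ D) (hj : 1 ≤ j) :
    ∃ C : ℝ, 0 < C ∧
      ∀ K : ℝ, 0 < K → K < 1 →
        ∀ v : Fin k → H → EuclideanSpace ℝ (Fin D),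
          (∀ i, ContDiff ℝ (⊤ : ℕ∞) (v i)) →
          (∀ i, ∀ p : H, ‖v i p‖ = 1) →
          (∀ i, CkRS 1 j 1 (v i) ≤ ENNReal.ofReal K) →
          (∀ p : H, Orthonormal ℝ (fun i => v i p)) →
            ∃ w : H → EuclideanSpace ℝ (Fin D), ContDiff ℝ (⊤ : ℕ∞) w ∧
              (∀ p : H, ‖w p‖ = 1) ∧
              CkRS 1 j 1 w ≤ ENNReal.ofReal (C * K) ∧
              ∀ p : H, ∀ i, ⟪w p, v i p⟫ = 0 := by
  obtain ⟨C, hC⟩ := exists_unit_normal (V := EuclideanSpace ℝ (Fin D)) (k := k)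
    (by simpa using hkD) j
  refine ⟨(j + 1) * 2 ^ (j + 1) * max C 1, by positivity, fun K hK hK1 v hv _ hvK hon => ?_⟩
  obtain ⟨w, hw, hw1, hwv, hwC⟩ := hC K hK hK1.le v hv hon fun i l hl1 hlj p =>
    norm_word_le_of_CkRS_le hK.le (hvK i) hl1 hlj p
  refine ⟨w, hw, hw1, ?_, hwv⟩
  rw [mul_assoc]
  refine CkRS_le_of_norm_word_le (by positivity) fun l hl1 hlj p => (hwC l hl1 hlj p).trans ?_
  gcongr
  exact le_max_left _ _
end
end

section
/- There exist a smooth map f: H → ℝ⁵, a constant c > 0, and constants C_j > 0 for each integer j ≥ 0 such that: f is Γ-automorphic, i.e. f(pγ) = f(p) for all p ∈ H and γ ∈ Γ; ‖f‖_{C^j} ≤ C_j for every j ≥ 0; and |Xf(p) ∧ Yf(p) ∧ Zf(p)| ≥ c for all p ∈ H. -/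
open scoped ENNReal NNReal RealInnerProductSpace BigOperators

noncomputable section

open Heisenberg

namespace Heisenberg

section Automorphic

/-- Invariance under the right action of the integer lattice `Γ`. -/
def IsAutomorphic {α : Type*} (φ : H → α) : Prop := ∀ p γ : H, inGamma γ → φ (mul p γ) = φ p

variable {F : Type*} [NormedAddCommGroup F] [NormedSpace ℝ F]

theorem exists_mem_Icc_mul_eq (p : H) :
    ∃ q ∈ Set.Icc (0 : H) 1, ∃ γ : H, inGamma γ ∧ mul q γ = p := by
  refine ⟨(Int.fract p.1, Int.fract p.2.1, Int.fract (p.2.2 - Int.fract p.1 * ⌊p.2.1⌋)), ?_,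
    (⌊p.1⌋, ⌊p.2.1⌋, ⌊p.2.2 - Int.fract p.1 * ⌊p.2.1⌋⌋), ⟨⟨_, rfl⟩, ⟨_, rfl⟩, ⟨_, rfl⟩⟩, ?_⟩
  · exact ⟨⟨Int.fract_nonneg _, Int.fract_nonneg _, Int.fract_nonneg _⟩,
      ⟨(Int.fract_lt_one _).le, (Int.fract_lt_one _).le, (Int.fract_lt_one _).le⟩⟩
  · refine Prod.ext ?_ (Prod.ext ?_ ?_)
    · exact Int.floor_add_fract _
    · exact Int.floor_add_fract _
    · simp only [mul, Int.floor_add_fract]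
      ring

theorem IsAutomorphic.exists_isMinOn {ψ : H → ℝ} (hψ : IsAutomorphic ψ) (hc : Continuous ψ) :
    ∃ q, ∀ p, ψ q ≤ ψ p := by
  obtain ⟨q, -, hq⟩ := (isCompact_Icc (a := (0 : H)) (b := 1)).exists_isMinOn
    ⟨0, ⟨le_rfl, zero_le_one⟩⟩ hc.continuousOn
  refine ⟨q, fun p => ?_⟩
  obtain ⟨r, hr, γ, hγ, rfl⟩ := exists_mem_Icc_mul_eq p
  rw [hψ r γ hγ]
  exact hq hr

theorem IsAutomorphic.exists_le {ψ : H → ℝ} (hψ : IsAutomorphic ψ) (hc : Continuous ψ) :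
    ∃ M, ∀ p, ψ p ≤ M := by
  have hneg : IsAutomorphic fun p => -ψ p := fun p γ hγ => congrArg Neg.neg (hψ p γ hγ)
  obtain ⟨q, hq⟩ := hneg.exists_isMinOn hc.neg
  exact ⟨ψ q, fun p => neg_le_neg_iff.1 (hq p)⟩

theorem fderiv_mul_right {φ : H → F} (hd : Differentiable ℝ φ) (hφ : IsAutomorphic φ)
    (p : H) {γ : H} (hγ : inGamma γ) (v : H) :
    fderiv ℝ φ (mul p γ) (v.1, v.2.1, v.2.2 + v.1 * γ.2.1) = fderiv ℝ φ p v := by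
  let R : H →L[ℝ] H := (ContinuousLinearMap.fst ℝ ℝ (ℝ × ℝ)).prod
    (((ContinuousLinearMap.fst ℝ ℝ ℝ).comp (ContinuousLinearMap.snd ℝ ℝ (ℝ × ℝ))).prod
      ((ContinuousLinearMap.snd ℝ ℝ ℝ).comp (ContinuousLinearMap.snd ℝ ℝ (ℝ × ℝ)) +
        γ.2.1 • ContinuousLinearMap.fst ℝ ℝ (ℝ × ℝ)))
  have hR : (fun q : H => mul q γ) = fun q => R q + γ := by
    funext q
    refine Prod.ext ?_ (Prod.ext ?_ ?_)
    · simp [mul, R, add_comm]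
    · simp [mul, R, add_comm]
    · simp [mul, R]
      ring
  have hm : HasFDerivAt (fun q : H => mul q γ) R p := by
    rw [hR]
    exact R.hasFDerivAt.add_const γ
  have h1 := (hd (mul p γ)).hasFDerivAt.comp p hm
  have h2 : (φ ∘ fun q : H => mul q γ) = φ := funext fun q => hφ q γ hγ
  rw [h2] at h1
  rw [h1.fderiv]
  simp [R, mul_comm]

theorem IsAutomorphic.xD {φ : H → F} (hd : Differentiable ℝ φ) (hφ : IsAutomorphic φ) :
    IsAutomorphic (XD φ) := fun p γ hγ => by
  have h := fderiv_mul_right hd hφ p hγ (1, 0, p.2.1)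
  simpa [XD, mul, add_comm] using h

theorem IsAutomorphic.yD {φ : H → F} (hd : Differentiable ℝ φ) (hφ : IsAutomorphic φ) :
    IsAutomorphic (YD φ) := fun p γ hγ => by
  have h := fderiv_mul_right hd hφ p hγ (0, 1, 0)
  simpa [YD] using h

theorem IsAutomorphic.zD {φ : H → F} (hd : Differentiable ℝ φ) (hφ : IsAutomorphic φ) :
    IsAutomorphic (ZD φ) := fun p γ hγ => by
  have h := fderiv_mul_right hd hφ p hγ (0, 0, 1)
  simpa [ZD] using h

theorem contDiff_xD {φ : H → F} (hφ : ContDiff ℝ (⊤ : ℕ∞) φ) : ContDiff ℝ (⊤ : ℕ∞) (XD φ) :=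
  (hφ.fderiv_right (m := (⊤ : ℕ∞)) (by simp)).clm_apply (by fun_prop)

theorem contDiff_yD {φ : H → F} (hφ : ContDiff ℝ (⊤ : ℕ∞) φ) : ContDiff ℝ (⊤ : ℕ∞) (YD φ) :=
  (hφ.fderiv_right (m := (⊤ : ℕ∞)) (by simp)).clm_apply (by fun_prop)

theorem contDiff_zD {φ : H → F} (hφ : ContDiff ℝ (⊤ : ℕ∞) φ) : ContDiff ℝ (⊤ : ℕ∞) (ZD φ) :=
  (hφ.fderiv_right (m := (⊤ : ℕ∞)) (by simp)).clm_apply (by fun_prop)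

theorem foldr_wD {φ : H → F} (hφ : ContDiff ℝ (⊤ : ℕ∞) φ) (ha : IsAutomorphic φ)
    (l : List Bool) :
    ContDiff ℝ (⊤ : ℕ∞) (l.foldr WD φ) ∧ IsAutomorphic (l.foldr WD φ) := by
  induction l with
  | nil => exact ⟨hφ, ha⟩
  | cons b l ih =>
    have hd := ih.1.differentiable (by simp)
    cases b
    · exact ⟨contDiff_yD ih.1, ih.2.yD hd⟩
    · exact ⟨contDiff_xD ih.1, ih.2.xD hd⟩

theorem exists_gradNorm_le {φ : H → F} (hφ : ContDiff ℝ (⊤ : ℕ∞) φ) (ha : IsAutomorphic φ)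
    (j : ℕ) : ∃ M, ∀ p, gradNorm j φ p ≤ M := by
  refine IsAutomorphic.exists_le (ψ := gradNorm j φ) (fun p γ hγ => ?_) ?_
  · simp only [gradNorm, (foldr_wD hφ ha _).2 p γ hγ]
  · have := fun w : Fin j → Bool => (foldr_wD hφ ha (List.ofFn w)).1.continuous
    unfold gradNorm
    fun_prop

theorem CkR_lt_top {φ : H → F} (hφ : ContDiff ℝ (⊤ : ℕ∞) φ) (ha : IsAutomorphic φ)
    (j : ℕ) (R : ℝ) : CkR j R φ < ⊤ := by
  refine ENNReal.sum_lt_top.2 fun i _ => ENNReal.mul_lt_top ENNReal.ofReal_lt_top ?_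
  obtain ⟨M, hM⟩ := exists_gradNorm_le hφ ha (0 + i)
  exact (iSup_le fun p => ENNReal.ofReal_le_ofReal (hM p)).trans_lt ENNReal.ofReal_lt_top

theorem wedgeNorm_pos {D k : ℕ} {v : Fin k → EuclideanSpace ℝ (Fin D)}
    (hv : LinearIndependent ℝ v) : 0 < wedgeNorm v :=
  Real.sqrt_pos.2 (Matrix.posDef_gram_of_linearIndependent hv).det_pos

theorem exists_le_wedgeNorm {D : ℕ} {f : H → EuclideanSpace ℝ (Fin D)}
    (hf : ContDiff ℝ (⊤ : ℕ∞) f) (ha : IsAutomorphic f)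
    (hinj : ∀ p, Function.Injective (fderiv ℝ f p)) :
    ∃ c, 0 < c ∧ ∀ p, c ≤ wedgeNorm ![XD f p, YD f p, ZD f p] := by
  have hd := hf.differentiable (by simp)
  obtain ⟨q, hq⟩ := IsAutomorphic.exists_isMinOn
    (ψ := fun p => wedgeNorm ![XD f p, YD f p, ZD f p])
    (fun p γ hγ => by
      simp only [ha.xD hd p γ hγ, ha.yD hd p γ hγ, ha.zD hd p γ hγ])
    (by
      have hX := (contDiff_xD hf).continuous
      have hY := (contDiff_yD hf).continuous
      have hZ := (contDiff_zD hf).continuous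
      have hv : ∀ i, Continuous fun p => (![XD f p, YD f p, ZD f p] : Fin 3 → _) i := by
        intro i
        fin_cases i <;> assumption
      unfold wedgeNorm
      refine Real.continuous_sqrt.comp (Continuous.matrix_det ?_)
      exact continuous_matrix fun i j => (hv i).inner (hv j))
  refine ⟨_, wedgeNorm_pos ?_, hq⟩
  have hli : LinearIndependent ℝ ![((1, 0, q.2.1) : H), (0, 1, 0), (0, 0, 1)] := by
    refine Fintype.linearIndependent_iff.2 fun g hg => ?_
    simp only [Fin.sum_univ_three, Matrix.cons_val, Prod.smul_mk, Prod.mk_add_mk, smul_eq_mul,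
      mul_zero, mul_one, add_zero, zero_add, Prod.mk_eq_zero] at hg
    obtain ⟨h0, h1, h2⟩ := hg
    rw [h0] at h2
    intro i
    fin_cases i
    · exact h0
    · exact h1
    · simpa using h2
  have := hli.map' (fderiv ℝ f q).toLinearMap (LinearMap.ker_eq_bot.2 (hinj q))
  have hv : (fderiv ℝ f q).toLinearMap ∘ ![((1, 0, q.2.1) : H), (0, 1, 0), (0, 0, 1)] =
      ![XD f q, YD f q, ZD f q] := by
    funext i
    fin_cases i <;> rfl
  exact hv ▸ this

end Automorphic

section Bump

/-- A smooth even bump function, positive exactly on `(-3/5, 3/5)`. -/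
def bump (s : ℝ) : ℝ := expNegInvGlue (9 / 25 - s ^ 2)

theorem contDiff_bump : ContDiff ℝ (⊤ : ℕ∞) bump :=
  expNegInvGlue.contDiff.comp (by fun_prop)

theorem bump_nonneg (s : ℝ) : 0 ≤ bump s := expNegInvGlue.nonneg _

theorem bump_pos {s : ℝ} (h : |s| < 3 / 5) : 0 < bump s :=
  expNegInvGlue.pos_of_pos (by nlinarith [abs_nonneg s, sq_abs s])

theorem bump_eq_zero {s : ℝ} (h : 3 / 5 ≤ |s|) : bump s = 0 :=
  expNegInvGlue.zero_of_nonpos (by nlinarith [abs_nonneg s, sq_abs s])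

theorem deriv_bump_ne_zero {s : ℝ} (h : |s| < 3 / 5) (h0 : s ≠ 0) : deriv bump s ≠ 0 := by
  have hpos : 0 < 9 / 25 - s ^ 2 := by nlinarith [abs_nonneg s, sq_abs s]
  have hev : bump =ᶠ[nhds s] fun t => Real.exp (-(9 / 25 - t ^ 2)⁻¹) := by
    have hc : ContinuousAt (fun t : ℝ => 9 / 25 - t ^ 2) s := by fun_prop
    filter_upwards [hc.eventually (lt_mem_nhds hpos)] with t ht
    simp [bump, expNegInvGlue, not_le.2 ht]
  have hder : HasDerivAt (fun t : ℝ => 9 / 25 - t ^ 2) (-(2 * s)) s := by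
    simpa using ((hasDerivAt_pow 2 s).const_sub (9 / 25))
  have hexp : HasDerivAt (fun t : ℝ => Real.exp (-(9 / 25 - t ^ 2)⁻¹)) _ s :=
    (hder.inv hpos.ne').neg.exp
  rw [hev.deriv_eq, hexp.deriv]
  simp [hpos.ne', h0]

end Bump

section Wave

/-- The character `exp(2πi(2z - nx))`. -/
def phase (n : ℤ) (p : H) : ℂ :=
  Complex.exp (((2 * Real.pi * (2 * p.2.2 - n * p.1) : ℝ) : ℂ) * Complex.I)

/-- A single mode, localised around `y = s`. -/
def mode (s : ℝ) (n : ℤ) (p : H) : ℂ := (bump (p.2.1 - s) : ℂ) * phase n p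

/-- The periodisation of a single mode. -/
def wave (s : ℝ) (n : ℤ) (p : H) : ℂ := ∑' k : ℤ, mode (s + k) (2 * k + n) p

theorem phase_ne_zero (n : ℤ) (p : H) : phase n p ≠ 0 := Complex.exp_ne_zero _

theorem phase_add_two {n : ℤ} {p : H} (hp : Real.cos (2 * Real.pi * p.1) = 0) :
    phase (n + 2) p = -phase n p := by
  have h : phase (n + 2) p = phase n p *
      Complex.exp (((-(2 * (2 * Real.pi * p.1)) : ℝ) : ℂ) * Complex.I) := by
    rw [phase, phase, ← Complex.exp_add]
    congr 1
    push_cast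
    ring
  rw [h, Complex.exp_mul_I, ← Complex.ofReal_cos, ← Complex.ofReal_sin, Real.cos_neg,
    Real.sin_neg, Real.cos_two_mul, Real.sin_two_mul, hp]
  simp

theorem contDiff_mode (s : ℝ) (n : ℤ) : ContDiff ℝ (⊤ : ℕ∞) (mode s n) := by
  have h1 : ContDiff ℝ (⊤ : ℕ∞) fun p : H => (bump (p.2.1 - s) : ℂ) :=
    Complex.ofRealCLM.contDiff.comp (contDiff_bump.comp (by fun_prop))
  have h2 : ContDiff ℝ (⊤ : ℕ∞) fun p : H => 2 * Real.pi * (2 * p.2.2 - n * p.1) := by fun_prop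
  exact h1.mul (((Complex.ofRealCLM.contDiff.comp h2).mul contDiff_const).cexp)

theorem fderiv_mode (s : ℝ) (n : ℤ) (p v : H) :
    fderiv ℝ (mode s n) p v =
      (((deriv bump (p.2.1 - s) * v.2.1 : ℝ) : ℂ) +
        ((bump (p.2.1 - s) * (2 * Real.pi * (2 * v.2.2 - n * v.1)) : ℝ) : ℂ) * Complex.I) *
        phase n p := by
  have hline : HasDerivAt (fun t : ℝ => p + t • v) v 0 := by
    simpa using ((hasDerivAt_id (0 : ℝ)).smul_const v).const_add p
  have hmode : HasFDerivAt (mode s n) (fderiv ℝ (mode s n) p) (p + (0 : ℝ) • v) := by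
    simpa using ((contDiff_mode s n).differentiable (by simp) p).hasFDerivAt
  have h1 := hmode.comp_hasDerivAt (0 : ℝ) hline
  have hb : HasDerivAt bump (deriv bump (p.2.1 - s)) (p.2.1 + 0 * v.2.1 - s) := by
    simpa using (contDiff_bump.differentiable (by simp) (p.2.1 - s)).hasDerivAt
  have hy : HasDerivAt (fun t : ℝ => p.2.1 + t * v.2.1 - s) v.2.1 0 := by
    simpa using (((hasDerivAt_id (0 : ℝ)).mul_const v.2.1).const_add p.2.1).sub_const s
  have hφ : HasDerivAt (fun t : ℝ => 2 * Real.pi * (2 * (p.2.2 + t * v.2.2) -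
      n * (p.1 + t * v.1))) (2 * Real.pi * (2 * v.2.2 - n * v.1)) 0 := by
    have hz := (((hasDerivAt_id (0 : ℝ)).mul_const v.2.2).const_add p.2.2).const_mul 2
    have hx := (((hasDerivAt_id (0 : ℝ)).mul_const v.1).const_add p.1).const_mul (n : ℝ)
    simpa using (hz.sub hx).const_mul (2 * Real.pi)
  have h2 := (hb.comp (0 : ℝ) hy).ofReal_comp.mul ((hφ.ofReal_comp.mul_const Complex.I).cexp)
  have h3 := h1.unique (h2.congr_of_eventuallyEq (Filter.Eventually.of_forall fun t => by
    simp [mode, phase]))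
  rw [h3]
  simp [phase]
  ring

theorem mode_eq_zero {s : ℝ} {n : ℤ} {p : H} (h : 3 / 5 ≤ |p.2.1 - s|) : mode s n p = 0 := by
  simp [mode, bump_eq_zero h]

theorem wave_eq_mode {s : ℝ} {n m : ℤ} {p : H} (h : |p.2.1 - (s + m)| < 2 / 5) :
    wave s n p = mode (s + m) (2 * m + n) p := by
  refine tsum_eq_single m fun k hk => mode_eq_zero ?_
  have h' := abs_lt.1 h
  rcases lt_or_gt_of_ne hk with hlt | hgt
  · have : (k : ℝ) + 1 ≤ m := by exact_mod_cast hlt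
    exact le_trans (by linarith) (le_abs_self _)
  · have : (m : ℝ) + 1 ≤ k := by exact_mod_cast hgt
    exact le_trans (by linarith) (neg_le_abs _)

theorem wave_eq_add {s : ℝ} {n m : ℤ} {p : H} (h1 : s + m - 2 / 5 < p.2.1)
    (h2 : p.2.1 < s + m + 7 / 5) :
    wave s n p = (mode (s + m) (2 * m + n) + mode (s + m + 1) (2 * m + n + 2)) p := by
  have hne : m ∉ ({m + 1} : Finset ℤ) := by simp
  rw [wave, tsum_eq_sum (s := {m, m + 1}), Finset.sum_insert hne, Finset.sum_singleton,
    Pi.add_apply]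
  · push_cast
    congr 2
    · ring
    · ring
  · intro k hk
    simp only [Finset.mem_insert, Finset.mem_singleton, not_or] at hk
    refine mode_eq_zero ?_
    rcases lt_or_gt_of_ne hk.1 with hlt | hgt
    · have : (k : ℝ) + 1 ≤ m := by exact_mod_cast hlt
      exact le_trans (by linarith) (le_abs_self _)
    · have : (m : ℝ) + 2 ≤ k := by
        have : m + 2 ≤ k := by omega
        exact_mod_cast this
      exact le_trans (by linarith) (neg_le_abs _)

theorem fderiv_wave_of_abs_lt {s : ℝ} {n m : ℤ} {p : H} (h : |p.2.1 - (s + m)| < 2 / 5) :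
    fderiv ℝ (wave s n) p = fderiv ℝ (mode (s + m) (2 * m + n)) p := by
  refine Filter.EventuallyEq.fderiv_eq ?_
  have hc : ContinuousAt (fun q : H => |q.2.1 - (s + m)|) p := by fun_prop
  filter_upwards [hc.eventually (gt_mem_nhds h)] with q hq using wave_eq_mode hq

theorem wave_eventuallyEq_add {s : ℝ} {n m : ℤ} {p : H} (h1 : s + m - 2 / 5 < p.2.1)
    (h2 : p.2.1 < s + m + 7 / 5) :
    wave s n =ᶠ[nhds p] mode (s + m) (2 * m + n) + mode (s + m + 1) (2 * m + n + 2) := by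
  have hc : ContinuousAt (fun q : H => q.2.1) p := by fun_prop
  filter_upwards [hc.eventually (lt_mem_nhds h1), hc.eventually (gt_mem_nhds h2)]
    with q hq1 hq2 using wave_eq_add hq1 hq2

theorem fderiv_wave {s : ℝ} {n m : ℤ} {p : H} (h1 : s + m - 2 / 5 < p.2.1)
    (h2 : p.2.1 < s + m + 7 / 5) (v : H) :
    fderiv ℝ (wave s n) p v = fderiv ℝ (mode (s + m) (2 * m + n)) p v +
      fderiv ℝ (mode (s + m + 1) (2 * m + n + 2)) p v := by
  have hd := fun s n => (contDiff_mode s n).differentiable (by simp) p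
  rw [(wave_eventuallyEq_add h1 h2).fderiv_eq, fderiv_add (hd _ _) (hd _ _)]
  rfl

theorem contDiff_wave (s : ℝ) (n : ℤ) : ContDiff ℝ (⊤ : ℕ∞) (wave s n) := by
  refine contDiff_iff_contDiffAt.2 fun p => ?_
  have h1 := Int.floor_le (p.2.1 - s)
  have h2 := Int.lt_floor_add_one (p.2.1 - s)
  exact ((contDiff_mode _ _).add (contDiff_mode _ _)).contDiffAt.congr_of_eventuallyEq
    (wave_eventuallyEq_add (m := ⌊p.2.1 - s⌋) (by linarith) (by linarith))

theorem isAutomorphic_wave (s : ℝ) (n : ℤ) : IsAutomorphic (wave s n) := by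
  rintro p γ ⟨⟨a, ha⟩, ⟨b, hb⟩, ⟨c, hc⟩⟩
  rw [wave, wave, ← (Equiv.addRight b).tsum_eq]
  refine tsum_congr fun k => ?_
  simp only [mode, phase, mul, ha, hb, hc, Equiv.coe_addRight]
  congr 1
  · push_cast
    congr 2
    ring
  · refine Complex.exp_eq_exp_iff_exists_int.2 ⟨2 * c - (2 * (k + b) + n) * a, ?_⟩
    push_cast
    ring

end Wave

section Immersion

/-- The immersion, with values in `ℂ × ℂ × ℝ`. -/
def immersion (p : H) : ℂ × ℂ × ℝ :=
  (wave 0 0 p, wave (3 / 10) 1 p, Real.sin (2 * Real.pi * p.1))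

theorem contDiff_sin_fst :
    ContDiff ℝ (⊤ : ℕ∞) fun p : H => Real.sin (2 * Real.pi * p.1) := by fun_prop

theorem contDiff_immersion : ContDiff ℝ (⊤ : ℕ∞) immersion :=
  (contDiff_wave _ _).prodMk ((contDiff_wave _ _).prodMk contDiff_sin_fst)

theorem isAutomorphic_immersion : IsAutomorphic immersion := by
  intro p γ hγ
  obtain ⟨a, ha⟩ := hγ.1
  refine Prod.ext (isAutomorphic_wave _ _ p γ hγ) (Prod.ext (isAutomorphic_wave _ _ p γ hγ) ?_)
  have : 2 * Real.pi * (a + p.1) = 2 * Real.pi * p.1 + a * (2 * Real.pi) := by ring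
  simp only [immersion, mul, ha, this, Real.sin_add_int_mul_two_pi]

theorem fderiv_sin_fst (p v : H) :
    fderiv ℝ (fun p : H => Real.sin (2 * Real.pi * p.1)) p v =
      Real.cos (2 * Real.pi * p.1) * (2 * Real.pi * v.1) := by
  have h : HasFDerivAt (fun p : H => 2 * Real.pi * p.1)
      ((2 * Real.pi) • ContinuousLinearMap.fst ℝ ℝ (ℝ × ℝ)) p :=
    (ContinuousLinearMap.fst ℝ ℝ (ℝ × ℝ)).hasFDerivAt.const_mul (2 * Real.pi)
  rw [h.sin.fderiv]
  simp

theorem fderiv_immersion (p v : H) :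
    fderiv ℝ immersion p v = (fderiv ℝ (wave 0 0) p v, fderiv ℝ (wave (3 / 10) 1) p v,
      Real.cos (2 * Real.pi * p.1) * (2 * Real.pi * v.1)) := by
  have hd := fun s n => (contDiff_wave s n).differentiable (by simp) p
  have h := (hd 0 0).hasFDerivAt.prodMk ((hd (3 / 10) 1).hasFDerivAt.prodMk
    (contDiff_sin_fst.differentiable (by simp) p).hasFDerivAt)
  have h' : fderiv ℝ immersion p = _ := h.fderiv
  rw [h', ← fderiv_sin_fst]
  rfl

/-- A tangent vector killed by one mode, by the sum of the two neighbouring modes, and by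
`sin (2πx)` vanishes. -/
theorem eq_zero_of_fderiv_mode_eq_zero {s s₁ s₂ : ℝ} {n n₁ n₂ : ℤ} {p v : H}
    (hn₁ : n₁ = n - 1) (hn₂ : n₂ = n₁ + 2) (hs : |p.2.1 - s| < 3 / 5) (hs0 : p.2.1 ≠ s)
    (hs12 : |p.2.1 - s₁| < 3 / 5 ∨ |p.2.1 - s₂| < 3 / 5)
    (h : fderiv ℝ (mode s n) p v = 0)
    (h12 : fderiv ℝ (mode s₁ n₁) p v + fderiv ℝ (mode s₂ n₂) p v = 0)
    (hcos : Real.cos (2 * Real.pi * p.1) * (2 * Real.pi * v.1) = 0) : v = 0 := by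
  have hpi := Real.pi_pos
  rw [fderiv_mode, mul_eq_zero, or_iff_left (phase_ne_zero _ _)] at h
  have hre := congrArg Complex.re h
  have him := congrArg Complex.im h
  simp only [Complex.add_re, Complex.add_im, Complex.ofReal_re, Complex.ofReal_im,
    Complex.re_ofReal_mul, Complex.im_ofReal_mul, Complex.I_re, Complex.I_im, Complex.zero_re,
    Complex.zero_im, mul_zero, mul_one, add_zero, zero_add] at hre him
  have hb : v.2.1 = 0 :=
    (mul_eq_zero.1 hre).resolve_left (deriv_bump_ne_zero hs (sub_ne_zero.2 hs0))
  have hc : 2 * v.2.2 - n * v.1 = 0 :=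
    (mul_eq_zero.1 ((mul_eq_zero.1 him).resolve_left (bump_pos hs).ne')).resolve_left
      (by positivity)
  have ha : v.1 = 0 := by
    by_contra ha
    have hcos0 : Real.cos (2 * Real.pi * p.1) = 0 :=
      (mul_eq_zero.1 hcos).resolve_right (by positivity)
    have e1 : 2 * v.2.2 - (n₁ : ℝ) * v.1 = v.1 := by
      rw [hn₁]
      push_cast
      linarith
    have e2 : 2 * v.2.2 - (n₂ : ℝ) * v.1 = -v.1 := by
      rw [hn₂, hn₁]
      push_cast
      linarith
    rw [fderiv_mode, fderiv_mode, hb, e1, e2, hn₂, phase_add_two hcos0] at h12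
    have h0 : (((bump (p.2.1 - s₁) + bump (p.2.1 - s₂)) * (2 * Real.pi * v.1) : ℝ) : ℂ) *
        (Complex.I * phase n₁ p) = 0 := by
      rw [← h12]
      push_cast
      ring
    have hsum : 0 < bump (p.2.1 - s₁) + bump (p.2.1 - s₂) := by
      rcases hs12 with hs1 | hs2
      · exact add_pos_of_pos_of_nonneg (bump_pos hs1) (bump_nonneg _)
      · exact add_pos_of_nonneg_of_pos (bump_nonneg _) (bump_pos hs2)
    rcases mul_eq_zero.1 h0 with h0 | h0
    · exact (mul_ne_zero hsum.ne' (by positivity)) (Complex.ofReal_eq_zero.1 h0)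
    · exact mul_ne_zero Complex.I_ne_zero (phase_ne_zero _ _) h0
  refine Prod.ext ha (Prod.ext hb ?_)
  rw [ha] at hc
  simpa using hc

theorem fderiv_immersion_injective (p : H) : Function.Injective (fderiv ℝ immersion p) := by
  refine (injective_iff_map_eq_zero _).2 fun v hv => ?_
  rw [fderiv_immersion, Prod.mk_eq_zero, Prod.mk_eq_zero] at hv
  obtain ⟨hA, hB, hcos⟩ := hv
  have first_pure : ∀ m : ℤ, -7 / 20 ≤ p.2.1 - m → p.2.1 - m ≤ 3 / 10 → p.2.1 ≠ m → v = 0 := by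
    intro m h1 h2 h0
    rw [fderiv_wave_of_abs_lt (m := m) (abs_lt.2 ⟨by linarith, by linarith⟩)] at hA
    rw [fderiv_wave (m := m - 1) (by push_cast; linarith) (by push_cast; linarith)] at hB
    refine eq_zero_of_fderiv_mode_eq_zero (by ring) rfl (abs_lt.2 ⟨by linarith, by linarith⟩)
      (by simpa using h0) ?_ hA hB hcos
    push_cast
    rcases le_or_gt (p.2.1 - m) (-3 / 10) with h | h
    · exact Or.inl (abs_lt.2 ⟨by linarith, by linarith⟩)
    · exact Or.inr (abs_lt.2 ⟨by linarith, by linarith⟩)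
  have h0 : (⌊p.2.1⌋ : ℝ) ≤ p.2.1 := Int.floor_le _
  have h1 : p.2.1 < ⌊p.2.1⌋ + 1 := Int.lt_floor_add_one _
  generalize ⌊p.2.1⌋ = k at h0 h1
  rcases le_or_gt (13 / 20) (p.2.1 - k) with h | h
  · exact first_pure (k + 1) (by push_cast; linarith) (by push_cast; linarith)
      (by push_cast; exact h1.ne)
  by_cases he : p.2.1 - k = 3 / 10
  · exact first_pure k (by linarith) he.le fun h => by linarith
  rw [fderiv_wave_of_abs_lt (m := k) (abs_lt.2 ⟨by linarith, by linarith⟩)] at hB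
  rw [fderiv_wave (m := k) (by linarith) (by linarith)] at hA
  refine eq_zero_of_fderiv_mode_eq_zero (by ring) rfl (abs_lt.2 ⟨by linarith, by linarith⟩)
    (fun h => he (by linarith)) ?_ hB hA hcos
  rcases le_or_gt (1 / 2) (p.2.1 - k) with h | h
  · exact Or.inr (abs_lt.2 ⟨by linarith, by linarith⟩)
  · exact Or.inl (abs_lt.2 ⟨by linarith, by linarith⟩)

end Immersion

end Heisenberg

/-- **A `Γ`-automorphic immersion into `ℝ⁵`** (from the proof of Proposition 4.2, via the
strong Whitney immersion theorem): a smooth `Γ`-automorphic map `f : H → ℝ⁵` with all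
`C^j` norms bounded and `|Xf(p) ∧ Yf(p) ∧ Zf(p)| ≥ c > 0` everywhere. -/
theorem statement10 :
    ∃ (f : H → EuclideanSpace ℝ (Fin 5)) (c : ℝ) (Cj : ℕ → ℝ),
      ContDiff ℝ (⊤ : ℕ∞) f ∧ 0 < c ∧ (∀ j : ℕ, 0 < Cj j) ∧
      (∀ p γ : H, inGamma γ → f (mul p γ) = f p) ∧
      (∀ j : ℕ, CkR j 1 f ≤ ENNReal.ofReal (Cj j)) ∧
      ∀ p : H, c ≤ wedgeNorm ![XD f p, YD f p, ZD f p] := by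
  let L : (ℂ × ℂ × ℝ) ≃L[ℝ] EuclideanSpace ℝ (Fin 5) :=
    ContinuousLinearEquiv.ofFinrankEq (by simp)
  have hf : ContDiff ℝ (⊤ : ℕ∞) (L ∘ immersion) := L.contDiff.comp contDiff_immersion
  have ha : IsAutomorphic (L ∘ immersion) := fun p γ hγ =>
    congrArg L (isAutomorphic_immersion p γ hγ)
  have hinj : ∀ p, Function.Injective (fderiv ℝ (L ∘ immersion) p) := fun p => by
    rw [L.comp_fderiv]
    exact L.injective.comp (fderiv_immersion_injective p)
  obtain ⟨c, hc, hw⟩ := exists_le_wedgeNorm hf ha hinj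
  refine ⟨L ∘ immersion, c, fun j => (CkR j 1 (L ∘ immersion)).toReal + 1, hf, hc,
    fun j => by positivity, ha, fun j => ?_, hw⟩
  calc CkR j 1 (L ∘ immersion)
      = ENNReal.ofReal (CkR j 1 (L ∘ immersion)).toReal :=
        (ENNReal.ofReal_toReal (CkR_lt_top hf ha j 1).ne).symm
    _ ≤ _ := ENNReal.ofReal_le_ofReal (by linarith)
end
end

section
/- Let D ≥ 4 and let ψ: H → ℝ^D be a smooth map such that for every p ∈ H the four vectors Xψ(p), XXψ(p), Yψ(p), YYψ(p) are linearly independent. Then for every smooth F = (F_X, F_Y): H → ℝ² there exists a smooth map φ: H → ℝ^D solving B(φ,ψ) = F. Indeed, any smooth φ satisfying the pointwise equations φ·Xψ = 0, φ·XXψ = −F_X, φ·Yψ = 0, φ·YYψ = −F_Y solves B(φ,ψ) = F, and such a φ exists (e.g. φ(p) = T_ψ(p)^*(T_ψ(p)T_ψ(p)^*)^{−1}(0, −F_X(p), 0, −F_Y(p)), where T_ψ(p): ℝ^D → ℝ⁴ is the linear map v ↦ (v·Xψ(p), v·XXψ(p), v·Yψ(p), v·YYψ(p))). -/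
open scoped ENNReal NNReal RealInnerProductSpace BigOperators

noncomputable section

open Heisenberg
open scoped RealInnerProductSpace

section LinearSystems

open Matrix

variable {E V ι : Type*} [NormedAddCommGroup E] [NormedSpace ℝ E]
  [NormedAddCommGroup V] [InnerProductSpace ℝ V] [Fintype ι] {n : ℕ∞}

theorem contDiff_matrix_det [DecidableEq ι] {A : E → Matrix ι ι ℝ}
    (hA : ∀ i j, ContDiff ℝ n fun p => A p i j) : ContDiff ℝ n fun p => (A p).det := by
  simp only [Matrix.det_apply']
  exact ContDiff.sum fun σ _ => contDiff_const.mul (contDiff_prod fun i _ => hA _ _)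

theorem contDiff_matrix_cramer [DecidableEq ι] {A : E → Matrix ι ι ℝ} {b : E → ι → ℝ}
    (hA : ∀ i j, ContDiff ℝ n fun p => A p i j) (hb : ∀ i, ContDiff ℝ n fun p => b p i) (i : ι) :
    ContDiff ℝ n fun p => (A p).cramer (b p) i := by
  simp only [Matrix.cramer_apply]
  refine contDiff_matrix_det fun j k => ?_
  by_cases hk : k = i
  · simpa [Matrix.updateCol_apply, hk] using hb j
  · simpa [Matrix.updateCol_apply, hk] using hA j k

/-- Prescribed inner products against a smooth family of linearly independent vectors can be
realised by a smooth function. -/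
theorem exists_contDiff_inner_eq {v : E → ι → V} {b : E → ι → ℝ}
    (hv : ∀ i, ContDiff ℝ n fun p => v p i) (hli : ∀ p, LinearIndependent ℝ (v p))
    (hb : ∀ i, ContDiff ℝ n fun p => b p i) :
    ∃ φ : E → V, ContDiff ℝ n φ ∧ ∀ p i, ⟪φ p, v p i⟫ = b p i := by
  classical
  have hG : ∀ i j, ContDiff ℝ n fun p => gram ℝ (v p) i j := fun i j => (hv i).inner ℝ (hv j)
  have hdet : ∀ p, (gram ℝ (v p)).det ≠ 0 := fun p =>
    det_gram_ne_zero_iff_linearIndependent.2 (hli p)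
  refine ⟨fun p => ∑ j, ((gram ℝ (v p)).cramer (b p) j / (gram ℝ (v p)).det) • v p j,
    ContDiff.sum fun j _ =>
      ((contDiff_matrix_cramer hG hb j).div (contDiff_matrix_det hG) hdet).smul (hv j),
    fun p i => ?_⟩
  have h := congrFun (mulVec_cramer (gram ℝ (v p)) (b p)) i
  simp only [mulVec, dotProduct, gram_apply, Pi.smul_apply, smul_eq_mul] at h
  rw [← mul_right_inj' (hdet p), ← h, sum_inner, Finset.mul_sum]
  refine Finset.sum_congr rfl fun j _ => ?_
  rw [real_inner_smul_left, real_inner_comm]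
  field_simp [hdet p]

end LinearSystems

namespace Heisenberg

variable {V : Type*} [NormedAddCommGroup V] [NormedSpace ℝ V]

theorem contDiff_XD {φ : H → V} (hφ : ContDiff ℝ (⊤ : ℕ∞) φ) : ContDiff ℝ (⊤ : ℕ∞) (XD φ) :=
  (hφ.fderiv_right (by simp)).clm_apply (by fun_prop)

theorem contDiff_YD {φ : H → V} (hφ : ContDiff ℝ (⊤ : ℕ∞) φ) : ContDiff ℝ (⊤ : ℕ∞) (YD φ) :=
  (hφ.fderiv_right (by simp)).clm_apply contDiff_const

end Heisenberg

theorem inner_fderiv_apply_of_inner_eq_zero {E V : Type*} [NormedAddCommGroup E]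
    [NormedSpace ℝ E] [NormedAddCommGroup V] [InnerProductSpace ℝ V] {f g : E → V}
    (hf : Differentiable ℝ f) (hg : Differentiable ℝ g) (h : ∀ p, ⟪f p, g p⟫ = 0) (p w : E) :
    ⟪fderiv ℝ f p w, g p⟫ = -⟪f p, fderiv ℝ g p w⟫ := by
  have h1 := fderiv_inner_apply ℝ (hf p) (hg p) w
  simp only [h, fderiv_fun_const, Pi.zero_apply, _root_.zero_apply] at h1
  linarith

/-- **Solving `B(φ,ψ) = F` under a freeness hypothesis** (Section 6 of the paper).
If `Xψ(p), XXψ(p), Yψ(p), YYψ(p)` are linearly independent at every point, then any smooth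
`φ` satisfying `φ·Xψ = 0`, `φ·XXψ = -F_X`, `φ·Yψ = 0`, `φ·YYψ = -F_Y` solves
`B(φ,ψ) = F`, and such a smooth `φ` exists. -/
theorem statement12 (D : ℕ) (hD : 4 ≤ D)
    (ψ : H → EuclideanSpace ℝ (Fin D)) (hψ : ContDiff ℝ (⊤ : ℕ∞) ψ)
    (hfree : ∀ p : H,
      LinearIndependent ℝ ![XD ψ p, XD (XD ψ) p, YD ψ p, YD (YD ψ) p])
    (FX FY : H → ℝ) (hFX : ContDiff ℝ (⊤ : ℕ∞) FX) (hFY : ContDiff ℝ (⊤ : ℕ∞) FY) :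
    (∀ φ : H → EuclideanSpace ℝ (Fin D), ContDiff ℝ (⊤ : ℕ∞) φ →
      (∀ p : H, ⟪φ p, XD ψ p⟫ = 0 ∧ ⟪φ p, XD (XD ψ) p⟫ = -FX p ∧
        ⟪φ p, YD ψ p⟫ = 0 ∧ ⟪φ p, YD (YD ψ) p⟫ = -FY p) →
      ∀ p : H, ⟪XD φ p, XD ψ p⟫ = FX p ∧ ⟪YD φ p, YD ψ p⟫ = FY p) ∧
    ∃ φ : H → EuclideanSpace ℝ (Fin D), ContDiff ℝ (⊤ : ℕ∞) φ ∧
      (∀ p : H, ⟪φ p, XD ψ p⟫ = 0 ∧ ⟪φ p, XD (XD ψ) p⟫ = -FX p ∧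
        ⟪φ p, YD ψ p⟫ = 0 ∧ ⟪φ p, YD (YD ψ) p⟫ = -FY p) ∧
      ∀ p : H, ⟪XD φ p, XD ψ p⟫ = FX p ∧ ⟪YD φ p, YD ψ p⟫ = FY p := by
  have htop : ((⊤ : ℕ∞) : WithTop ℕ∞) ≠ 0 := by simp
  have hX := contDiff_XD hψ
  have hY := contDiff_YD hψ
  have hsolves : ∀ φ : H → EuclideanSpace ℝ (Fin D), ContDiff ℝ (⊤ : ℕ∞) φ →
      (∀ p : H, ⟪φ p, XD ψ p⟫ = 0 ∧ ⟪φ p, XD (XD ψ) p⟫ = -FX p ∧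
        ⟪φ p, YD ψ p⟫ = 0 ∧ ⟪φ p, YD (YD ψ) p⟫ = -FY p) →
      ∀ p : H, ⟪XD φ p, XD ψ p⟫ = FX p ∧ ⟪YD φ p, YD ψ p⟫ = FY p := by
    intro φ hφ h p
    obtain ⟨-, hXX, -, hYY⟩ := h p
    have hφd := hφ.differentiable htop
    have h1 := inner_fderiv_apply_of_inner_eq_zero hφd (hX.differentiable htop)
      (fun q => (h q).1) p (1, 0, p.2.1)
    have h2 := inner_fderiv_apply_of_inner_eq_zero hφd (hY.differentiable htop)
      (fun q => (h q).2.2.1) p (0, 1, 0)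
    exact ⟨h1.trans (neg_eq_iff_eq_neg.2 hXX), h2.trans (neg_eq_iff_eq_neg.2 hYY)⟩
  refine ⟨hsolves, ?_⟩
  obtain ⟨φ, hφ, h⟩ := exists_contDiff_inner_eq (n := ⊤)
    (v := fun p => ![XD ψ p, XD (XD ψ) p, YD ψ p, YD (YD ψ) p])
    (b := fun p => ![0, -FX p, 0, -FY p])
    (Fin.forall_fin_succ.2 ⟨hX, Fin.forall_fin_succ.2 ⟨contDiff_XD hX,
      Fin.forall_fin_two.2 ⟨hY, contDiff_YD hY⟩⟩⟩) hfree
    (Fin.forall_fin_succ.2 ⟨contDiff_const, Fin.forall_fin_succ.2 ⟨hFX.neg,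
      Fin.forall_fin_two.2 ⟨contDiff_const, hFY.neg⟩⟩⟩)
  have hφψ : ∀ p : H, ⟪φ p, XD ψ p⟫ = 0 ∧ ⟪φ p, XD (XD ψ) p⟫ = -FX p ∧
      ⟪φ p, YD ψ p⟫ = 0 ∧ ⟪φ p, YD (YD ψ) p⟫ = -FY p :=
    fun p => ⟨h p 0, h p 1, h p 2, h p 3⟩
  exact ⟨φ, hφ, hφψ, hsolves φ hφ hφψ⟩
end
end
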